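/- Let n ≥ 2, p ∈ [2,∞), q ∈ [p,∞), s,t ∈ (0,1) with t ≤ s, 1/p' ≤ tq/(sp) ≤ 1, a measurable symmetric with 0 ≤ a ≤ M, ε ∈ (0,s/p) with ε < 1−s, and let u ∈ W^{s,p}(ℝⁿ) ∩ L^∞(ℝⁿ) (any such function, not necessarily a solution). Then there exists a constant C_nd depending only on n,p,q,s,t,M,‖u‖_{L^∞} and independent of ε, such that for every integer k and every pair of axis-parallel cubes K₁, K₂ of side length 2^{−k} with 2^{−k} ≤ dist(K₁,K₂) ≤ 3, writing 𝒦 = K₁×K₂: ( ⨍_{𝒦} H^{p'} dν )^{1/p'} ≤ C_nd ( ⨍_{𝒦} H^γ dν )^{1/γ} + C_nd ε^{−1/γ} ( 2^{−k} / dist(K₁,K₂) )^{(p−1)(s+ε)} [ ( ⨍_{K₁×K₁} H^γ dν )^{1/γ} + ( ⨍_{K₂×K₂} H^γ dν )^{1/γ} ]. -/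

import Mathlib

open MeasureTheory Metric Set
open scoped ENNReal

noncomputable section

/-- `ℝⁿ` as a Euclidean space. -/
abbrev En (n : ℕ) := EuclideanSpace ℝ (Fin n)

/-- The Hölder conjugate `p' = p/(p−1)`. -/
def pC (p : ℝ) : ℝ := p / (p - 1)

/-- The lower Sobolev exponent `p_* = np'/(n+sp')`. -/
def pStar (n : ℕ) (p s : ℝ) : ℝ := (n : ℝ) * pC p / ((n : ℝ) + s * pC p)

/-- The integrand `P(x,y,u)` of the double phase energy `ℰ(u,u)`:
`|u(x)−u(y)|^p/|x−y|^{n+sp} + a(x,y)|u(x)−u(y)|^q/|x−y|^{n+tq}`. -/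
def energyIntegrand (n : ℕ) (p q s t : ℝ) (a : En n × En n → ℝ) (u : En n → ℝ)
    (z : En n × En n) : ℝ :=
  |u z.1 - u z.2| ^ p / ‖z.1 - z.2‖ ^ ((n : ℝ) + s * p)
    + a z * |u z.1 - u z.2| ^ q / ‖z.1 - z.2‖ ^ ((n : ℝ) + t * q)

/-- The integrand of the double phase form `ℰ(u,φ)`. -/
def formIntegrand (n : ℕ) (p q s t : ℝ) (a : En n × En n → ℝ) (u φ : En n → ℝ)
    (z : En n × En n) : ℝ :=
  |u z.1 - u z.2| ^ (p - 2) * (u z.1 - u z.2) * (φ z.1 - φ z.2)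
      / ‖z.1 - z.2‖ ^ ((n : ℝ) + s * p)
    + a z * (|u z.1 - u z.2| ^ (q - 2) * (u z.1 - u z.2) * (φ z.1 - φ z.2))
        / ‖z.1 - z.2‖ ^ ((n : ℝ) + t * q)

/-- `u ∈ W^{s,p}(ℝⁿ)`: `u` is measurable, `u ∈ L^p(ℝⁿ)`, and the Gagliardo seminorm
`∬ |u(x)−u(y)|^p/|x−y|^{n+sp} dy dx` is finite. -/
def MemWsp (n : ℕ) (s p : ℝ) (u : En n → ℝ) : Prop :=
  Measurable u ∧ (∫⁻ x, ENNReal.ofReal (|u x| ^ p)) < ⊤ ∧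
    (∫⁻ z : En n × En n,
      ENNReal.ofReal (|u z.1 - u z.2| ^ p / ‖z.1 - z.2‖ ^ ((n : ℝ) + s * p))) < ⊤

/-- `u` is a bounded weak solution of `ℒu = f`: the double phase energy `ℰ(u,u)` is finite
and `ℰ(u,φ) = ∫ fφ` for every test function `φ ∈ C_c^∞(ℝⁿ)`. -/
def IsBoundedWeakSolution (n : ℕ) (p q s t : ℝ) (a : En n × En n → ℝ)
    (u f : En n → ℝ) : Prop :=
  (∫⁻ z : En n × En n, ENNReal.ofReal (energyIntegrand n p q s t a u z)) < ⊤ ∧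
  ∀ φ : En n → ℝ, ContDiff ℝ (⊤ : ℕ∞) φ → HasCompactSupport φ →
    (∫ z : En n × En n, formIntegrand n p q s t a u φ z) = ∫ x, f x * φ x

/-- The dual-pair measure `ν` on `ℝⁿ × ℝⁿ`, with density `|x−y|^{−(n−εp)}`. -/
def nu (n : ℕ) (p ε : ℝ) : Measure (En n × En n) :=
  volume.withDensity fun z => ENNReal.ofReal (‖z.1 - z.2‖ ^ (ε * p - n))

/-- The diagonal ball `𝓑(x₀,R) = B(x₀,R) × B(x₀,R) ⊂ ℝ^{2n}`. -/
def bB (n : ℕ) (x₀ : En n) (R : ℝ) : Set (En n × En n) := ball x₀ R ×ˢ ball x₀ R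

/-- The exponent `η = (np + εp²)/(n + sp + εp)`. -/
def etaEx (n : ℕ) (p s ε : ℝ) : ℝ := ((n : ℝ) * p + ε * p ^ 2) / ((n : ℝ) + s * p + ε * p)

/-- The exponent `γ = η/(p−1) = p'(n+εp)/(n+sp+εp)`. -/
def gammaEx (n : ℕ) (p s ε : ℝ) : ℝ :=
  pC p * (((n : ℝ) + ε * p) / ((n : ℝ) + s * p + ε * p))

/-- The exponent `θ = (s − ε(p−1))/(n + εp)`. -/
def thetaEx (n : ℕ) (p s ε : ℝ) : ℝ := (s - ε * (p - 1)) / ((n : ℝ) + ε * p)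

/-- `U(x,y) = |u(x)−u(y)|/|x−y|^{s+ε}`. -/
def Ufun (n : ℕ) (s ε : ℝ) (u : En n → ℝ) (z : En n × En n) : ℝ :=
  |u z.1 - u z.2| / ‖z.1 - z.2‖ ^ (s + ε)

/-- `A(x,y) = a(x,y)|x−y|^{(s−t)q+ε(q−p)}`. -/
def Afun (n : ℕ) (p q s t ε : ℝ) (a : En n × En n → ℝ) (z : En n × En n) : ℝ :=
  a z * ‖z.1 - z.2‖ ^ ((s - t) * q + ε * (q - p))

/-- `G(x,y,U) = U^p + A(x,y) U^q`. -/
def Gfun (n : ℕ) (p q s t ε : ℝ) (a : En n × En n → ℝ) (u : En n → ℝ)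
    (z : En n × En n) : ℝ :=
  Ufun n s ε u z ^ p + Afun n p q s t ε a z * Ufun n s ε u z ^ q

/-- `H(x,y,U) = G(x,y,U)^{(p−1)/p}`. -/
def Hfun (n : ℕ) (p q s t ε : ℝ) (a : En n × En n → ℝ) (u : En n → ℝ)
    (z : En n × En n) : ℝ :=
  Gfun n p q s t ε a u z ^ ((p - 1) / p)

/-- The half-open axis-parallel cube in `ℝⁿ` with corner `c` and side length `ℓ`. -/
def cube (n : ℕ) (c : En n) (ℓ : ℝ) : Set (En n) :=
  {y | ∀ i, c i ≤ y i ∧ y i < c i + ℓ}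

/-- Euclidean distance between two subsets of `ℝⁿ`. -/
def setDistE {n : ℕ} (A B : Set (En n)) : ℝ := sInf (Set.image2 dist A B)

theorem cube_eq_preimage (n : ℕ) (c : En n) (ℓ : ℝ) :
    cube n c ℓ = (WithLp.ofLp : En n → (Fin n → ℝ)) ⁻¹' (Set.univ.pi fun i => Set.Ico (c i) (c i + ℓ)) := by
  ext y
  simp [cube, Set.mem_pi]

theorem cube_meas (n : ℕ) (c : En n) (ℓ : ℝ) : MeasurableSet (cube n c ℓ) := by
  rw [cube_eq_preimage]
  exact (PiLp.volume_preserving_ofLp (Fin n)).measurable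
    (MeasurableSet.univ_pi fun i => measurableSet_Ico)

theorem cube_vol (n : ℕ) (c : En n) (ℓ : ℝ) : volume (cube n c ℓ) = ENNReal.ofReal ℓ ^ n := by
  rw [cube_eq_preimage, (PiLp.volume_preserving_ofLp (Fin n)).measure_preimage
    (MeasurableSet.univ_pi fun i => measurableSet_Ico).nullMeasurableSet, Real.volume_pi_Ico]
  simp

theorem cube_norm_le (n : ℕ) (c : En n) (ℓ : ℝ) (hℓ : 0 ≤ ℓ) (x y : En n)
    (hx : x ∈ cube n c ℓ) (hy : y ∈ cube n c ℓ) : ‖x - y‖ ≤ Real.sqrt n * ℓ := by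
  rw [EuclideanSpace.norm_eq]
  rw [Real.sqrt_le_left (by positivity), mul_pow, Real.sq_sqrt (by positivity)]
  calc ∑ i, ‖(x - y) i‖ ^ 2 ≤ ∑ i : Fin n, ℓ ^ 2 := by
        apply Finset.sum_le_sum
        intro i _
        have h1 := hx i
        have h2 := hy i
        have : |(x - y) i| ≤ ℓ := by
          rw [abs_le]; simp only [PiLp.sub_apply]; constructor <;> linarith
        rw [Real.norm_eq_abs]
        gcongr
    _ = n * ℓ ^ 2 := by simp

theorem subcube (n : ℕ) (c : En n) (ℓ r : ℝ) (hℓ : 0 < ℓ) (hr : 0 < r) (hrℓ : r ≤ ℓ) (x : En n)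
    (hx : x ∈ cube n c ℓ) : ∃ c' : En n, x ∈ cube n c' r ∧ cube n c' r ⊆ cube n c ℓ := by
  refine ⟨WithLp.toLp 2 (fun i => c i + (x i - c i) * (1 - r / ℓ)), ?_, ?_⟩
  · intro i
    have h := hx i
    have h2 : (x i - c i) * (r / ℓ) < r := by
      rw [mul_div_assoc', div_lt_iff₀ hℓ]; nlinarith
    have h3 : 0 ≤ (x i - c i) * (r / ℓ) := mul_nonneg (by linarith) (by positivity)
    simp only
    constructor <;> nlinarith
  · intro y hy i
    have h := hx i
    have h1 := hy i
    simp only at h1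
    have h4 : 0 ≤ 1 - r / ℓ := by
      rw [sub_nonneg, div_le_one hℓ]; exact hrℓ
    have h5 : (x i - c i) * (1 - r / ℓ) ≤ ℓ * (1 - r/ℓ) := by
      apply mul_le_mul_of_nonneg_right _ h4; linarith
    have h6 : ℓ * (1 - r/ℓ) = ℓ - r := by field_simp
    have h7 : 0 ≤ (x i - c i) * (1 - r / ℓ) := mul_nonneg (by linarith) h4
    constructor <;> linarith

theorem ball_kernel (n : ℕ) (hn : 2 ≤ n) (δ R : ℝ) (hδ : 0 < δ) (hR : 0 < R) :
    ∫⁻ y : En n in ball 0 R, ENNReal.ofReal (‖y‖ ^ (δ - n)) =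
      ENNReal.ofReal (n * volume.real (ball (0 : En n) 1) * (R ^ δ / δ)) := by
  have : Nontrivial (En n) := by
    have : Nonempty (Fin n) := ⟨⟨0, by omega⟩⟩
    infer_instance
  have hfr : Module.finrank ℝ (En n) = n := by simp
  have key : ∀ y ∈ Ioo (0:ℝ) R, y ^ (n - 1) • (y ^ (δ - n)) = y ^ (δ - 1) := by
    intro y hy
    rw [smul_eq_mul, ← Real.rpow_natCast, ← Real.rpow_add hy.1]
    congr 1
    rw [Nat.cast_sub (by omega)]; push_cast; ring
  have hint0 : IntegrableOn (fun y : ℝ => y ^ (δ - 1)) (Ioo 0 R) :=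
    (intervalIntegral.integrableOn_Ioo_rpow_iff hR).2 (by linarith)
  have hIntg : IntegrableOn (fun x : En n => ‖x‖ ^ (δ - n)) (ball 0 R) := by
    rw [integrableOn_fun_norm_addHaar volume (f := fun t => t ^ (δ - n)), hfr]
    rw [integrableOn_congr_fun key measurableSet_Ioo]
    exact hint0
  rw [← ofReal_integral_eq_lintegral_ofReal hIntg (Filter.Eventually.of_forall fun x => by positivity)]
  congr 1
  rw [← integral_indicator measurableSet_ball]
  have e : (ball (0 : En n) R).indicator (fun x : En n => ‖x‖ ^ (δ - n)) =
      fun x => (Iio R).indicator (fun t : ℝ => t ^ (δ - n)) ‖x‖ := by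
    ext x; simp [indicator]
  rw [e, integral_fun_norm_addHaar volume ((Iio R).indicator (fun t : ℝ => t ^ (δ - n))), hfr]
  have e2 : ∫ y in Ioi (0:ℝ), y ^ (n - 1) • (Iio R).indicator (fun t : ℝ => t ^ (δ - n)) y
      = ∫ y in Ioo 0 R, y ^ (δ - 1) := by
    rw [← integral_indicator measurableSet_Ioi, ← integral_indicator measurableSet_Ioo]
    congr 1
    ext y
    by_cases h0 : 0 < y <;> by_cases h1 : y < R <;> simp [indicator, h0, h1]
    exact key y ⟨h0, h1⟩
  rw [e2, ← integral_Ioc_eq_integral_Ioo, ← intervalIntegral.integral_of_le hR.le,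
    integral_rpow (Or.inl (by linarith))]
  simp only [sub_add_cancel, nsmul_eq_mul, smul_eq_mul, Real.zero_rpow hδ.ne', sub_zero]
  ring

theorem cube_kernel (n : ℕ) (hn : 2 ≤ n) (δ : ℝ) (hδ : 0 < δ) (hδ1 : δ ≤ 1) (c : En n) (ℓ : ℝ)
    (hℓ : 0 < ℓ) (x : En n) (hx : x ∈ cube n c ℓ) :
    ∫⁻ y in cube n c ℓ, ENNReal.ofReal (‖x - y‖ ^ (δ - n)) ≤
      ENNReal.ofReal (n * volume.real (ball (0 : En n) 1) * (2 * Real.sqrt n) * (ℓ ^ δ / δ)) := by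
  have hsn : 1 ≤ Real.sqrt n := by
    rw [Real.one_le_sqrt]; exact_mod_cast (by omega : 1 ≤ n)
  set R := 2 * Real.sqrt n * ℓ with hRd
  have hR : 0 < R := by positivity
  calc ∫⁻ y in cube n c ℓ, ENNReal.ofReal (‖x - y‖ ^ (δ - n))
      ≤ ∫⁻ y in (fun y => x - y) ⁻¹' (ball 0 R), ENNReal.ofReal (‖x - y‖ ^ (δ - n)) := by
        apply lintegral_mono_set
        intro y hy
        have := cube_norm_le n c ℓ hℓ.le x y hx hy
        simp only [mem_preimage, mem_ball_zero_iff]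
        have : 0 < Real.sqrt n * ℓ := by positivity
        rw [hRd]; linarith
    _ = ∫⁻ y : En n in ball 0 R, ENNReal.ofReal (‖y‖ ^ (δ - n)) := by
        have hmp : MeasurePreserving (fun y : En n => x - y) volume volume :=
          Measure.measurePreserving_sub_left volume x
        exact hmp.setLIntegral_comp_preimage (f := fun y : En n => ENNReal.ofReal (‖y‖ ^ (δ - n)))
          measurableSet_ball (by fun_prop)
    _ = _ := ball_kernel n hn δ R hδ hR
    _ ≤ _ := by
        apply ENNReal.ofReal_le_ofReal
        have h1 : R ^ δ ≤ (2 * Real.sqrt n) * ℓ ^ δ := by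
          rw [hRd, Real.mul_rpow (by positivity) hℓ.le]
          gcongr
          calc (2 * Real.sqrt n) ^ δ ≤ (2 * Real.sqrt n) ^ (1:ℝ) :=
                Real.rpow_le_rpow_of_exponent_le (by linarith) hδ1
            _ = _ := Real.rpow_one _
        calc n * volume.real (ball (0 : En n) 1) * (R ^ δ / δ)
            ≤ n * volume.real (ball (0 : En n) 1) * ((2 * Real.sqrt n) * ℓ ^ δ / δ) := by gcongr
          _ = _ := by ring


theorem real_rpow_add_le {a b η : ℝ} (ha : 0 ≤ a) (hb : 0 ≤ b) (hη : 1 ≤ η) :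
    (a + b) ^ η ≤ 2 ^ (η - 1) * (a ^ η + b ^ η) := by
  lift a to NNReal using ha
  lift b to NNReal using hb
  exact_mod_cast NNReal.rpow_add_le_mul_rpow_add_rpow a b hη

theorem bdd_intOn (n : ℕ) (c : En n) (ℓ : ℝ) (f : En n → ℝ) (hf : Measurable f) (B : ℝ)
    (hB : ∀ x, |f x| ≤ B) : IntegrableOn f (cube n c ℓ) := by
  apply Measure.integrableOn_of_bounded (M := B)
  · rw [cube_vol]; finiteness
  · exact hf.aestronglyMeasurable
  · exact Filter.Eventually.of_forall fun x => by simpa using hB x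

theorem cube_volr (n : ℕ) (c : En n) (ℓ : ℝ) (hℓ : 0 ≤ ℓ) : volume.real (cube n c ℓ) = ℓ ^ n := by
  rw [Measure.real, cube_vol]; simp [hℓ]

theorem cube_avg (n : ℕ) (c : En n) (ℓ : ℝ) (hℓ : 0 ≤ ℓ) (f : En n → ℝ) :
    ⨍ y in cube n c ℓ, f y = (ℓ ^ n)⁻¹ * ∫ y in cube n c ℓ, f y := by
  rw [setAverage_eq, cube_volr n c ℓ hℓ, smul_eq_mul]

theorem avg_rpow_le (n : ℕ) (c : En n) (ℓ : ℝ) (hℓ : 0 < ℓ) (f : En n → ℝ) (hf : Measurable f)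
    (B : ℝ) (hB : ∀ x, f x ≤ B) (h0 : ∀ x, 0 ≤ f x) (b : ℝ) (hb : 1 ≤ b) :
    (⨍ y in cube n c ℓ, f y) ^ b ≤ ⨍ y in cube n c ℓ, f y ^ b := by
  refine (convexOn_rpow hb).map_set_average_le (Real.continuous_rpow_const (by linarith)).continuousOn isClosed_Ici ?_ ?_ ?_ ?_ ?_
  · rw [cube_vol]; simp [hℓ]
  · rw [cube_vol]; finiteness
  · exact Filter.Eventually.of_forall fun x => h0 x
  · exact bdd_intOn n c ℓ f hf B fun x => by rw [abs_of_nonneg (h0 x)]; exact hB x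
  · refine bdd_intOn n c ℓ _ (hf.pow_const b) (B ^ b) fun x => ?_
    rw [Function.comp_apply, abs_of_nonneg (Real.rpow_nonneg (h0 x) _)]
    exact Real.rpow_le_rpow (h0 x) (hB x) (by linarith)

/-- the Gagliardo kernel -/
def Jk (n : ℕ) (η κ : ℝ) (u : En n → ℝ) (x y : En n) : ℝ := |u x - u y| ^ η * ‖x - y‖ ^ (-κ)

theorem local_est (n : ℕ) (η κ : ℝ) (hη : 1 ≤ η) (hκ : 0 < κ) (u : En n → ℝ) (hu : Measurable u)
    (Λ : ℝ) (hΛ : ∀ x, |u x| ≤ Λ) (c c' : En n) (ℓ r : ℝ) (hr : 0 < r)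
    (hQ : cube n c' r ⊆ cube n c ℓ) (x : En n) (hx : x ∈ cube n c' r)
    (D : ℝ) (hD0 : 0 ≤ D) (hD : ∫⁻ y in cube n c ℓ, ENNReal.ofReal (Jk n η κ u x y) = ENNReal.ofReal D) :
    ⨍ y in cube n c' r, |u x - u y| ^ η ≤ Real.sqrt n ^ κ * r ^ (κ - n) * D := by
  have hbd : ∀ y, |u x - u y| ≤ 2 * Λ := fun y => by
    have := abs_sub (u x) (u y); have := hΛ x; have := hΛ y
    have h3 : |u x - u y| ≤ |u x| + |u y| := by simpa using abs_sub_le (u x) 0 (u y)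
    linarith
  have hIntg : IntegrableOn (fun y => |u x - u y| ^ η) (cube n c' r) := by
    refine bdd_intOn n c' r _ (by fun_prop) ((2*Λ) ^ η) fun y => ?_
    rw [abs_of_nonneg (by positivity)]
    exact Real.rpow_le_rpow (abs_nonneg _) (hbd y) (by linarith)
  have key : ∫ y in cube n c' r, |u x - u y| ^ η ≤ (Real.sqrt n * r) ^ κ * D := by
    rw [← ENNReal.ofReal_le_ofReal_iff (by positivity),
      ofReal_integral_eq_lintegral_ofReal hIntg (Filter.Eventually.of_forall fun y => by positivity),
      ENNReal.ofReal_mul (by positivity), ← hD]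
    calc ∫⁻ y in cube n c' r, ENNReal.ofReal (|u x - u y| ^ η)
        ≤ ∫⁻ y in cube n c' r, ENNReal.ofReal ((Real.sqrt n * r) ^ κ) * ENNReal.ofReal (Jk n η κ u x y) := by
          apply setLIntegral_mono' (cube_meas n c' r)
          intro y hy
          rw [← ENNReal.ofReal_mul (by positivity)]
          apply ENNReal.ofReal_le_ofReal
          by_cases hxy : x = y
          · subst hxy; simp [Jk, Real.zero_rpow (by linarith : η ≠ 0)]
          have hpos : 0 < ‖x - y‖ := norm_pos_iff.2 (sub_ne_zero.2 hxy)
          have h1 := cube_norm_le n c' r hr.le x y hx hy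
          calc |u x - u y| ^ η = ‖x - y‖ ^ κ * (|u x - u y| ^ η * ‖x - y‖ ^ (-κ)) := by
                rw [Real.rpow_neg hpos.le]; field_simp
            _ ≤ _ := by
                unfold Jk
                gcongr
      _ = ENNReal.ofReal ((Real.sqrt n * r) ^ κ) * ∫⁻ y in cube n c' r, ENNReal.ofReal (Jk n η κ u x y) := by
          rw [lintegral_const_mul' _ _ ENNReal.ofReal_ne_top]
      _ ≤ _ := by
          gcongr
  rw [cube_avg n c' r hr.le]
  calc (r ^ n)⁻¹ * ∫ y in cube n c' r, |u x - u y| ^ η ≤ (r ^ n)⁻¹ * ((Real.sqrt n * r) ^ κ * D) := by gcongr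
    _ = _ := by
      rw [Real.mul_rpow (by positivity) hr.le, Real.rpow_sub hr, Real.rpow_natCast]; field_simp

theorem pw_mean (n : ℕ) (η κ : ℝ) (hη : 1 ≤ η) (hκ : 0 < κ) (u : En n → ℝ) (hu : Measurable u)
    (Λ : ℝ) (hΛ : ∀ x, |u x| ≤ Λ) (c : En n) (ℓ : ℝ) (hℓ : 0 < ℓ)
    (x : En n) (hx : x ∈ cube n c ℓ)
    (D : ℝ) (hD0 : 0 ≤ D) (hD : ∫⁻ y in cube n c ℓ, ENNReal.ofReal (Jk n η κ u x y) = ENNReal.ofReal D) :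
    |u x - ⨍ y in cube n c ℓ, u y| ^ η ≤ Real.sqrt n ^ κ * ℓ ^ (κ - n) * D := by
  refine le_trans ?_ (local_est n η κ hη hκ u hu Λ hΛ c c ℓ ℓ hℓ subset_rfl x hx D hD0 hD)
  have hbd : ∀ y, |u x - u y| ≤ 2 * Λ := fun y => by
    have := hΛ x; have := hΛ y
    have h3 : |u x - u y| ≤ |u x| + |u y| := by simpa using abs_sub_le (u x) 0 (u y)
    linarith
  refine le_trans ?_ (avg_rpow_le n c ℓ hℓ (fun y => |u x - u y|) (by fun_prop) (2 * Λ) hbd (fun _ => abs_nonneg _) η hη)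
  apply Real.rpow_le_rpow (abs_nonneg _) _ (by linarith)
  have hV : (0:ℝ) < ℓ ^ n := by positivity
  have e : u x - ⨍ y in cube n c ℓ, u y = (ℓ ^ n)⁻¹ * ∫ y in cube n c ℓ, (u x - u y) := by
    rw [cube_avg n c ℓ hℓ.le, integral_sub, setIntegral_const, cube_volr n c ℓ hℓ.le, smul_eq_mul]
    · field_simp
    · exact integrableOn_const (by rw [cube_vol]; finiteness)
    · exact bdd_intOn n c ℓ u hu Λ hΛ
  rw [e, cube_avg n c ℓ hℓ.le, abs_mul, abs_of_pos (inv_pos.2 hV)]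
  gcongr
  exact abs_integral_le_integral_abs

theorem pw_small (n : ℕ) (p η κ : ℝ) (hη : 1 ≤ η) (hηp : η < p) (hκ : 0 < κ)
    (hcrit : n * (η / p) = 2 * n - κ) (u : En n → ℝ) (hu : Measurable u)
    (Λ : ℝ) (hΛ : ∀ x, |u x| ≤ Λ) (c : En n) (ℓ r m : ℝ) (hℓ : 0 < ℓ) (hr : 0 < r) (hrℓ : r ≤ ℓ)
    (x : En n) (hx : x ∈ cube n c ℓ)
    (D : ℝ) (hD0 : 0 ≤ D) (hD : ∫⁻ y in cube n c ℓ, ENNReal.ofReal (Jk n η κ u x y) = ENNReal.ofReal D) :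
    |u x - m| ^ η ≤ 2 ^ (η - 1) * (Real.sqrt n ^ κ * r ^ (κ - n) * D
      + (∫ y in cube n c ℓ, |u y - m| ^ p) ^ (η / p) * r ^ (κ - 2 * n)) := by
  obtain ⟨c', hxc, hQ⟩ := subcube n c ℓ r hℓ hr hrℓ x hx
  have h1 := local_est n η κ hη hκ u hu Λ hΛ c c' ℓ r hr hQ x hxc D hD0 hD
  have hbd : ∀ y, |u x - u y| ≤ 2 * Λ := fun y => by
    have := hΛ x; have := hΛ y
    have h3 : |u x - u y| ≤ |u x| + |u y| := by simpa using abs_sub_le (u x) 0 (u y)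
    linarith
  have hbm : ∀ y, |u y - m| ≤ Λ + |m| := fun y => by
    have := hΛ y
    have h3 : |u y - m| ≤ |u y| + |m| := by simpa using abs_sub_le (u y) 0 m
    linarith
  have hp0 : 0 < p := by linarith
  have hbb : ∀ y, ∀ b : ℝ, 0 < b → |(|u y - m| ^ b)| ≤ (Λ + |m|) ^ b := fun y b hb => by
    rw [abs_of_nonneg (by positivity)]
    exact Real.rpow_le_rpow (abs_nonneg _) (hbm y) hb.le
  have hI1 : IntegrableOn (fun y => |u x - u y| ^ η) (cube n c' r) := by
    refine bdd_intOn n c' r _ (by fun_prop) ((2*Λ) ^ η) fun y => ?_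
    rw [abs_of_nonneg (by positivity)]
    exact Real.rpow_le_rpow (abs_nonneg _) (hbd y) (by linarith)
  have hI2 : IntegrableOn (fun y => |u y - m| ^ η) (cube n c' r) :=
    bdd_intOn n c' r _ (by fun_prop) _ fun y => hbb y η (by linarith)
  have hI3 : IntegrableOn (fun y => |u y - m| ^ p) (cube n c ℓ) :=
    bdd_intOn n c ℓ _ (by fun_prop) _ fun y => hbb y p (by linarith)
  have hV : (0:ℝ) < r ^ n := by positivity
  set N := ∫ y in cube n c ℓ, |u y - m| ^ p with hN
  have hN0 : 0 ≤ N := integral_nonneg fun y => by positivity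
  have h2 : ⨍ y in cube n c' r, |u y - m| ^ η ≤ N ^ (η / p) * r ^ (κ - 2 * n) := by
    have h3 := avg_rpow_le n c' r hr (fun y => |u y - m| ^ η) (by fun_prop) ((Λ + |m|) ^ η)
      (fun y => (le_abs_self _).trans (hbb y η (by linarith))) (fun y => by positivity) (p / η)
      (by rw [le_div_iff₀ (by linarith)]; linarith)
    have h4 : ∀ y, (|u y - m| ^ η) ^ (p / η) = |u y - m| ^ p := fun y => by
      rw [← Real.rpow_mul (abs_nonneg _)]; congr 1; field_simp
    simp only [h4] at h3
    have h5 : ⨍ y in cube n c' r, |u y - m| ^ p ≤ (r ^ n)⁻¹ * N := by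
      rw [cube_avg n c' r hr.le]
      gcongr
      exact setIntegral_mono_set hI3 (Filter.Eventually.of_forall fun y => by positivity)
        (Filter.Eventually.of_forall hQ)
    have h6 : 0 ≤ ⨍ y in cube n c' r, |u y - m| ^ η := by
      rw [cube_avg n c' r hr.le]
      have : 0 ≤ ∫ y in cube n c' r, |u y - m| ^ η := integral_nonneg fun y => by positivity
      positivity
    have h7 := Real.rpow_le_rpow (by positivity) (h3.trans h5) (by positivity : 0 ≤ η / p)
    rw [← Real.rpow_mul h6] at h7
    have h8 : p / η * (η / p) = 1 := by
      have : η ≠ 0 := by linarith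
      field_simp
    rw [h8, Real.rpow_one] at h7
    refine h7.trans (le_of_eq ?_)
    rw [Real.mul_rpow (by positivity) hN0, ← Real.rpow_natCast, ← Real.rpow_neg hr.le, ← Real.rpow_mul hr.le, mul_comm]
    congr 2
    linarith
  calc |u x - m| ^ η = (r ^ n)⁻¹ * ∫ y in cube n c' r, |u x - m| ^ η := by
        rw [setIntegral_const, cube_volr n c' r hr.le, smul_eq_mul]; field_simp
    _ ≤ (r ^ n)⁻¹ * ∫ y in cube n c' r, 2 ^ (η - 1) * (|u x - u y| ^ η + |u y - m| ^ η) := by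
        refine mul_le_mul_of_nonneg_left ?_ (by positivity)
        apply integral_mono
        · exact integrableOn_const (by rw [cube_vol]; finiteness)
        · exact (hI1.add hI2).const_mul _
        · intro y
          refine le_trans ?_ (real_rpow_add_le (abs_nonneg _) (abs_nonneg _) hη)
          exact Real.rpow_le_rpow (abs_nonneg _) (abs_sub_le _ _ _) (by linarith)
    _ = 2 ^ (η - 1) * ((⨍ y in cube n c' r, |u x - u y| ^ η) + ⨍ y in cube n c' r, |u y - m| ^ η) := by
        rw [integral_const_mul, integral_add hI1 hI2, cube_avg n c' r hr.le, cube_avg n c' r hr.le]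
        ring
    _ ≤ _ := by gcongr


/-- the constant in the Sobolev-Poincare inequality -/
def Csob (n : ℕ) (p : ℝ) : ℝ := (2 ^ p * (n : ℝ) ^ n) ^ p

theorem pw_final (n : ℕ) (hn : 2 ≤ n) (p η κ : ℝ) (hη : 1 ≤ η) (hηp : η < p) (hκ : n < κ)
    (hcrit : n * (η / p) = 2 * n - κ) (u : En n → ℝ) (hu : Measurable u)
    (Λ : ℝ) (hΛ : ∀ x, |u x| ≤ Λ) (c : En n) (ℓ m : ℝ) (hℓ : 0 < ℓ)
    (hm : m = ⨍ y in cube n c ℓ, u y) (N : ℝ) (hN : N = ∫ y in cube n c ℓ, |u y - m| ^ p)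
    (hN0 : 0 < N)
    (x : En n) (hx : x ∈ cube n c ℓ)
    (D : ℝ) (hD0 : 0 ≤ D) (hD : ∫⁻ y in cube n c ℓ, ENNReal.ofReal (Jk n η κ u x y) = ENNReal.ofReal D) :
    |u x - m| ^ p ≤ Csob n p * N ^ (1 - η / p) * D := by
  have hn1 : (1:ℝ) ≤ n := by exact_mod_cast (by omega : 1 ≤ n)
  have hκ0 : 0 < κ := by linarith
  have hp0 : 0 < p := by linarith
  have hη0 : 0 < η := by linarith
  have hA := pw_mean n η κ hη hκ0 u hu Λ hΛ c ℓ hℓ x hx D hD0 hD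
  rw [← hm] at hA
  have hs1 : 1 ≤ Real.sqrt n := by rw [Real.one_le_sqrt]; exact hn1
  have hB1 : 1 ≤ Real.sqrt n ^ κ := Real.one_le_rpow hs1 hκ0.le
  have hθ0 : 0 < η / p := by positivity
  have hBn : Real.sqrt n ^ κ ≤ (n:ℝ) ^ n := by
    calc Real.sqrt n ^ κ ≤ Real.sqrt n ^ (2 * (n:ℝ)) := by
          apply Real.rpow_le_rpow_of_exponent_le hs1
          nlinarith
      _ = (n:ℝ) ^ n := by
          rw [Real.rpow_mul (by positivity), Real.rpow_two, Real.sq_sqrt (by positivity), Real.rpow_natCast]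
  have h2p : (1:ℝ) ≤ 2 ^ p := Real.one_le_rpow (by norm_num) hp0.le
  set Cs : ℝ := 2 ^ p * (n:ℝ) ^ n with hCs
  have hCs1 : 1 ≤ Cs := by
    rw [hCs]; nlinarith [hB1.trans hBn]
  rcases hD0.eq_or_lt with h0 | hDpos
  · rw [← h0, mul_zero] at hA
    have : |u x - m| = 0 := by
      by_contra hne
      have : 0 < |u x - m| := lt_of_le_of_ne (abs_nonneg _) (Ne.symm hne)
      have := Real.rpow_pos_of_pos this η
      linarith
    rw [this, ← h0, Real.zero_rpow hp0.ne', mul_zero]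
  set θ := η / p with hθ
  have hn0 : (0:ℝ) < n := by linarith
  set r := (N ^ θ / D) ^ (1 / (n:ℝ)) with hr
  have hNθ : 0 < N ^ θ := Real.rpow_pos_of_pos hN0 _
  have hq : 0 < N ^ θ / D := by positivity
  have hr0 : 0 < r := Real.rpow_pos_of_pos hq _
  have hrn : r ^ (n:ℝ) = N ^ θ / D := by
    rw [hr, ← Real.rpow_mul hq.le]; simp [hn0.ne']
  have hrα : r ^ (κ - n) = (N ^ θ / D) ^ (1 - θ) := by
    rw [hr, ← Real.rpow_mul hq.le]
    congr 1
    field_simp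
    linarith
  have main : |u x - m| ^ η ≤ Cs * (r ^ (κ - n) * D) := by
    by_cases hrl : r ≤ ℓ
    · have h := pw_small n p η κ hη hηp hκ0 hcrit u hu Λ hΛ c ℓ r m hℓ hr0 hrl x hx D hD0 hD
      rw [← hN] at h
      have e : N ^ θ * r ^ (κ - 2 * n) = r ^ (κ - n) * D := by
        have : κ - 2 * n = (κ - n) - n := by ring
        rw [this, Real.rpow_sub hr0 (κ - n) n, hrn]; field_simp
      rw [e] at h
      refine h.trans ?_
      have h2 : (2:ℝ) ^ (η - 1) * 2 ≤ 2 ^ p := by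
        have : (2:ℝ) ^ (η - 1) * 2 = 2 ^ η := by
          rw [Real.rpow_sub (by norm_num), Real.rpow_one]; ring
        rw [this]; exact Real.rpow_le_rpow_of_exponent_le (by norm_num) hηp.le
      have hX : 0 ≤ r ^ (κ - n) * D := by positivity
      calc (2:ℝ) ^ (η - 1) * (Real.sqrt n ^ κ * r ^ (κ - n) * D + r ^ (κ - n) * D)
          ≤ (2:ℝ) ^ (η - 1) * ((n:ℝ) ^ n * (r ^ (κ - n) * D) + (n:ℝ) ^ n * (r ^ (κ - n) * D)) := by
            apply mul_le_mul_of_nonneg_left _ (by positivity)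
            have h5 := mul_le_mul_of_nonneg_right hBn hX
            have h6 := mul_le_mul_of_nonneg_right (hB1.trans hBn) hX
            linarith
        _ = ((2:ℝ) ^ (η - 1) * 2) * (n:ℝ) ^ n * (r ^ (κ - n) * D) := by ring
        _ ≤ _ := by rw [hCs]; gcongr
    · push Not at hrl
      refine hA.trans ?_
      rw [mul_assoc]
      have : ℓ ^ (κ - n) ≤ r ^ (κ - n) := Real.rpow_le_rpow hℓ.le hrl.le (by linarith)
      have : Real.sqrt n ^ κ ≤ Cs := by rw [hCs]; nlinarith
      gcongr
  have e2 : r ^ (κ - n) * D = (N ^ (1 - θ) * D) ^ θ := by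
    rw [hrα, Real.div_rpow hNθ.le hD0, Real.mul_rpow (by positivity) hD0, ← Real.rpow_mul hN0.le, ← Real.rpow_mul hN0.le,
      Real.rpow_sub hDpos, Real.rpow_one]
    have : D ^ θ ≠ 0 := (Real.rpow_pos_of_pos hDpos _).ne'
    rw [mul_comm θ]
    field_simp
  rw [e2] at main
  have hθi : 0 < 1 / θ := by positivity
  have h9 := Real.rpow_le_rpow (by positivity) main hθi.le
  have hND : 0 ≤ N ^ (1 - θ) * D := by positivity
  rw [Real.mul_rpow (by linarith) (by positivity), ← Real.rpow_mul (abs_nonneg _), ← Real.rpow_mul hND] at h9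
  have e3 : η * (1 / θ) = p := by rw [hθ]; field_simp
  have e4 : θ * (1 / θ) = 1 := by field_simp
  rw [e3, e4, Real.rpow_one] at h9
  refine h9.trans ?_
  rw [mul_assoc]
  refine mul_le_mul_of_nonneg_right ?_ hND
  unfold Csob
  apply Real.rpow_le_rpow_of_exponent_le hCs1
  rw [hθ, one_div_div, div_le_iff₀ hη0]
  nlinarith

theorem sobolev (n : ℕ) (hn : 2 ≤ n) (p η κ : ℝ) (hη : 1 ≤ η) (hηp : η < p) (hκ : n < κ)
    (hcrit : n * (η / p) = 2 * n - κ) (u : En n → ℝ) (hu : Measurable u)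
    (Λ : ℝ) (hΛ : ∀ x, |u x| ≤ Λ) (c : En n) (ℓ m : ℝ) (hℓ : 0 < ℓ)
    (hm : m = ⨍ y in cube n c ℓ, u y) (N : ℝ) (hN : N = ∫ y in cube n c ℓ, |u y - m| ^ p) :
    ENNReal.ofReal (N ^ (η / p)) ≤ ENNReal.ofReal (Csob n p) *
      ∫⁻ x in cube n c ℓ, ∫⁻ y in cube n c ℓ, ENNReal.ofReal (Jk n η κ u x y) := by
  have hp0 : 0 < p := by linarith
  have hη0 : 0 < η := by linarith
  have hN0 : 0 ≤ N := by rw [hN]; exact integral_nonneg fun y => by positivity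
  have hn0 : (0:ℝ) < n := by exact_mod_cast (by omega : 0 < n)
  have hC : 0 < Csob n p := by unfold Csob; positivity
  rcases hN0.eq_or_lt with h0 | hNpos
  · rw [← h0, Real.zero_rpow (by positivity)]; simp
  have hI3 : IntegrableOn (fun y => |u y - m| ^ p) (cube n c ℓ) := by
    refine bdd_intOn n c ℓ _ (by fun_prop) ((Λ + |m|) ^ p) fun y => ?_
    rw [abs_of_nonneg (by positivity)]
    have := hΛ y
    have h3 : |u y - m| ≤ |u y| + |m| := by simpa using abs_sub_le (u y) 0 m
    exact Real.rpow_le_rpow (abs_nonneg _) (by linarith) hp0.le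
  set θ := η / p with hθ
  set E := ∫⁻ x in cube n c ℓ, ∫⁻ y in cube n c ℓ, ENNReal.ofReal (Jk n η κ u x y) with hE
  have hNp : 0 < N ^ (1 - θ) := Real.rpow_pos_of_pos hNpos _
  have h1 : ENNReal.ofReal N ≤ ENNReal.ofReal (Csob n p * N ^ (1 - θ)) * E := by
    rw [hE, ← lintegral_const_mul' _ _ ENNReal.ofReal_ne_top]
    nth_rewrite 1 [hN]
    rw [ofReal_integral_eq_lintegral_ofReal hI3 (Filter.Eventually.of_forall fun y => by positivity)]
    apply setLIntegral_mono' (cube_meas n c ℓ)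
    intro x hx
    by_cases htop : ∫⁻ y in cube n c ℓ, ENNReal.ofReal (Jk n η κ u x y) = ⊤
    · rw [htop, ENNReal.mul_top]
      · exact le_top
      · simp only [ne_eq, ENNReal.ofReal_eq_zero, not_le]; positivity
    · have hD := (ENNReal.ofReal_toReal htop).symm
      rw [hD, ← ENNReal.ofReal_mul (by positivity)]
      apply ENNReal.ofReal_le_ofReal
      exact pw_final n hn p η κ hη hηp hκ hcrit u hu Λ hΛ c ℓ m hℓ hm N hN hNpos x hx _
        ENNReal.toReal_nonneg hD
  calc ENNReal.ofReal (N ^ θ) = ENNReal.ofReal (N ^ (θ - 1)) * ENNReal.ofReal N := by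
        rw [← ENNReal.ofReal_mul (by positivity), Real.rpow_sub hNpos, Real.rpow_one]
        congr 1; field_simp
    _ ≤ ENNReal.ofReal (N ^ (θ - 1)) * (ENNReal.ofReal (Csob n p * N ^ (1 - θ)) * E) := by gcongr
    _ = _ := by
        rw [← mul_assoc, ← ENNReal.ofReal_mul (by positivity)]
        congr 2
        have : N ^ (θ - 1) * N ^ (1 - θ) = 1 := by
          rw [← Real.rpow_add hNpos]; simp
        linear_combination (Csob n p) * this


theorem ofReal_comb {a b c d : ℝ} (hb : 0 ≤ b) (hc : 0 ≤ c) (hd : 0 ≤ d)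
    (h : ENNReal.ofReal a ≤ 2 * ENNReal.ofReal b + 2 * ENNReal.ofReal c + ENNReal.ofReal d) :
    a ≤ 2 * b + 2 * c + d := by
  have two : (2 : ℝ≥0∞) = ENNReal.ofReal 2 := by simp
  rwa [two, ← ENNReal.ofReal_mul (by norm_num), ← ENNReal.ofReal_mul (by norm_num),
    ← ENNReal.ofReal_add (by positivity) (by positivity),
    ← ENNReal.ofReal_add (by positivity) (by positivity),
    ENNReal.ofReal_le_ofReal_iff (by positivity)] at h

theorem lpn_eq {α : Type*} [MeasurableSpace α] (μ : Measure α) [IsProbabilityMeasure μ] (f : α → ℝ)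
    (hf : Measurable f) (B : ℝ) (hB : ∀ x, |f x| ≤ B) (p : ℝ) (hp : 1 ≤ p) :
    eLpNorm f (ENNReal.ofReal p) μ = ENNReal.ofReal ((∫ x, |f x| ^ p ∂μ) ^ (1 / p)) := by
  have h : MemLp f (ENNReal.ofReal p) μ :=
    MemLp.of_bound hf.aestronglyMeasurable B (Filter.Eventually.of_forall fun x => by simpa using hB x)
  rw [h.eLpNorm_eq_integral_rpow_norm (by simp; linarith) ENNReal.ofReal_ne_top,
    ENNReal.toReal_ofReal (by linarith), one_div]
  simp only [Real.norm_eq_abs]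

theorem tri (n : ℕ) (μ₁ μ₂ : Measure (En n)) [IsProbabilityMeasure μ₁] [IsProbabilityMeasure μ₂]
    (u : En n → ℝ) (hu : Measurable u) (Λ : ℝ) (hΛ : ∀ x, |u x| ≤ Λ) (m₁ m₂ p η : ℝ)
    (hη : 1 ≤ η) (hηp : η ≤ p) :
    (∫ z, |u z.1 - u z.2| ^ p ∂(μ₁.prod μ₂)) ^ (1 / p) ≤
      2 * (∫ x, |u x - m₁| ^ p ∂μ₁) ^ (1 / p) + 2 * (∫ x, |u x - m₂| ^ p ∂μ₂) ^ (1 / p)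
        + (∫ z, |u z.1 - u z.2| ^ η ∂(μ₁.prod μ₂)) ^ (1 / η) := by
  set μ := μ₁.prod μ₂ with hμ
  have hprob : IsProbabilityMeasure μ := by rw [hμ]; infer_instance
  have hp : 1 ≤ p := hη.trans hηp
  have hbd : ∀ z : En n × En n, |u z.1 - u z.2| ≤ 2 * Λ := fun z => by
    have := hΛ z.1; have := hΛ z.2
    have h3 : |u z.1 - u z.2| ≤ |u z.1| + |u z.2| := by simpa using abs_sub_le (u z.1) 0 (u z.2)
    linarith
  have hbm : ∀ m y, |u y - m| ≤ Λ + |m| := fun m y => by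
    have := hΛ y
    have h3 : |u y - m| ≤ |u y| + |m| := by simpa using abs_sub_le (u y) 0 m
    linarith
  have e1 := lpn_eq μ (fun z => u z.1 - u z.2) (by fun_prop) _ hbd p hp
  have e2 := lpn_eq μ (fun z => u z.1 - u z.2) (by fun_prop) _ hbd η hη
  have e3 := lpn_eq μ₁ (fun z => u z - m₁) (by fun_prop) _ (hbm m₁) p hp
  have e4 := lpn_eq μ₂ (fun z => u z - m₂) (by fun_prop) _ (hbm m₂) p hp
  have hp1 : 1 ≤ ENNReal.ofReal p := by rw [← ENNReal.ofReal_one]; exact ENNReal.ofReal_le_ofReal hp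
  have hη1 : 1 ≤ ENNReal.ofReal η := by rw [← ENNReal.ofReal_one]; exact ENNReal.ofReal_le_ofReal hη
  have hle : ENNReal.ofReal η ≤ ENNReal.ofReal p := ENNReal.ofReal_le_ofReal hηp
  let f₁ : En n × En n → ℝ := fun z => u z.1 - m₁
  let f₂ : En n × En n → ℝ := fun z => u z.2 - m₂
  let g : En n × En n → ℝ := fun z => u z.1 - u z.2
  let k : En n × En n → ℝ := fun _ => m₁ - m₂
  have hf₁ : AEStronglyMeasurable f₁ μ := by
    have : Measurable f₁ := by fun_prop
    exact this.aestronglyMeasurable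
  have hf₂ : AEStronglyMeasurable f₂ μ := by
    have : Measurable f₂ := by fun_prop
    exact this.aestronglyMeasurable
  have hg : AEStronglyMeasurable g μ := by
    have : Measurable g := by fun_prop
    exact this.aestronglyMeasurable
  have hk : AEStronglyMeasurable k μ := aestronglyMeasurable_const
  have c1 : eLpNorm f₁ (ENNReal.ofReal p) μ = eLpNorm (fun x => u x - m₁) (ENNReal.ofReal p) μ₁ := by
    have hm : Measurable (fun x => u x - m₁) := by fun_prop
    have hmp : MeasurePreserving Prod.fst μ μ₁ := measurePreserving_fst
    have hh := eLpNorm_comp_measurePreserving (p := ENNReal.ofReal p) hm.aestronglyMeasurable hmp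
    rw [← hh]
    rfl
  have c2 : eLpNorm f₂ (ENNReal.ofReal p) μ = eLpNorm (fun x => u x - m₂) (ENNReal.ofReal p) μ₂ := by
    have hm : Measurable (fun x => u x - m₂) := by fun_prop
    have hmp : MeasurePreserving Prod.snd μ μ₂ := measurePreserving_snd
    have hh := eLpNorm_comp_measurePreserving (p := ENNReal.ofReal p) hm.aestronglyMeasurable hmp
    rw [← hh]
    rfl
  have d1 : eLpNorm f₁ (ENNReal.ofReal η) μ ≤ eLpNorm f₁ (ENNReal.ofReal p) μ :=
    eLpNorm_le_eLpNorm_of_exponent_le hle hf₁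
  have d2 : eLpNorm f₂ (ENNReal.ofReal η) μ ≤ eLpNorm f₂ (ENNReal.ofReal p) μ :=
    eLpNorm_le_eLpNorm_of_exponent_le hle hf₂
  have hk1 : eLpNorm k (ENNReal.ofReal p) μ = eLpNorm k (ENNReal.ofReal η) μ := by
    rw [eLpNorm_const _ (by positivity) (IsProbabilityMeasure.ne_zero μ),
      eLpNorm_const _ (by positivity) (IsProbabilityMeasure.ne_zero μ)]
    simp
  have hkle : eLpNorm k (ENNReal.ofReal η) μ ≤ eLpNorm g (ENNReal.ofReal η) μ
      + eLpNorm f₁ (ENNReal.ofReal η) μ + eLpNorm f₂ (ENNReal.ofReal η) μ := by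
    have : k = (g - f₁) + f₂ := by ext z; simp [k, g, f₁, f₂]
    rw [this]
    refine (eLpNorm_add_le (hg.sub hf₁) hf₂ hη1).trans ?_
    gcongr
    exact eLpNorm_sub_le hg hf₁ hη1
  have hgle : eLpNorm g (ENNReal.ofReal p) μ ≤ eLpNorm f₁ (ENNReal.ofReal p) μ
      + eLpNorm k (ENNReal.ofReal p) μ + eLpNorm f₂ (ENNReal.ofReal p) μ := by
    have : g = (f₁ + k) - f₂ := by ext z; simp [k, g, f₁, f₂]
    rw [this]
    refine (eLpNorm_sub_le (hf₁.add hk) hf₂ hp1).trans ?_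
    gcongr
    exact eLpNorm_add_le hf₁ hk hp1
  have hfin : eLpNorm g (ENNReal.ofReal p) μ ≤ 2 * eLpNorm f₁ (ENNReal.ofReal p) μ
      + 2 * eLpNorm f₂ (ENNReal.ofReal p) μ + eLpNorm g (ENNReal.ofReal η) μ := by
    calc _ ≤ _ := hgle
      _ ≤ eLpNorm f₁ (ENNReal.ofReal p) μ + (eLpNorm g (ENNReal.ofReal η) μ
        + eLpNorm f₁ (ENNReal.ofReal p) μ + eLpNorm f₂ (ENNReal.ofReal p) μ) + eLpNorm f₂ (ENNReal.ofReal p) μ := by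
          rw [hk1]
          gcongr
          refine hkle.trans ?_
          gcongr
      _ = _ := by ring
  rw [c1, c2, e3, e4] at hfin
  change eLpNorm g _ _ = _ at e1 e2
  rw [e1, e2] at hfin
  have t1 : ∀ (ν : Measure (En n)) (m b c : ℝ), 0 ≤ (∫ x, |u x - m| ^ b ∂ν) ^ c := fun ν m b c =>
    Real.rpow_nonneg (integral_nonneg fun x => by positivity) _
  have t2 : ∀ (b c : ℝ), 0 ≤ (∫ z, |u z.1 - u z.2| ^ b ∂μ) ^ c := fun b c =>
    Real.rpow_nonneg (integral_nonneg fun x => by positivity) _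
  exact ofReal_comb (t1 _ _ _ _) (t1 _ _ _ _) (t2 _ _) hfin

theorem cube_tri (n : ℕ) (c₁ c₂ : En n) (ℓ : ℝ) (hℓ : 0 < ℓ)
    (u : En n → ℝ) (hu : Measurable u) (Λ : ℝ) (hΛ : ∀ x, |u x| ≤ Λ) (m₁ m₂ p η : ℝ)
    (hη : 1 ≤ η) (hηp : η ≤ p) :
    ((ℓ ^ n)⁻¹ * (ℓ ^ n)⁻¹ * ∫ z in cube n c₁ ℓ ×ˢ cube n c₂ ℓ, |u z.1 - u z.2| ^ p) ^ (1 / p) ≤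
      2 * ((ℓ ^ n)⁻¹ * ∫ x in cube n c₁ ℓ, |u x - m₁| ^ p) ^ (1 / p)
        + 2 * ((ℓ ^ n)⁻¹ * ∫ x in cube n c₂ ℓ, |u x - m₂| ^ p) ^ (1 / p)
        + ((ℓ ^ n)⁻¹ * (ℓ ^ n)⁻¹ * ∫ z in cube n c₁ ℓ ×ˢ cube n c₂ ℓ, |u z.1 - u z.2| ^ η) ^ (1 / η) := by
  let μ : En n → Measure (En n) := fun c => (ENNReal.ofReal (ℓ ^ n))⁻¹ • volume.restrict (cube n c ℓ)
  have hV : 0 < ℓ ^ n := by positivity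
  have hpr : ∀ c, IsProbabilityMeasure (μ c) := fun c => ⟨by
    simp only [μ, Measure.smul_apply, Measure.restrict_apply_univ, cube_vol, smul_eq_mul]
    rw [← ENNReal.ofReal_pow hℓ.le]
    exact ENNReal.inv_mul_cancel (by simpa using hV) ENNReal.ofReal_ne_top⟩
  have hI : ∀ c (f : En n → ℝ), ∫ x, f x ∂(μ c) = (ℓ ^ n)⁻¹ * ∫ x in cube n c ℓ, f x := fun c f => by
    simp only [μ]
    rw [integral_smul_measure, ENNReal.toReal_inv, ENNReal.toReal_ofReal hV.le, smul_eq_mul]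
  have hI2 : ∀ (f : En n × En n → ℝ), ∫ z, f z ∂((μ c₁).prod (μ c₂)) =
      (ℓ ^ n)⁻¹ * (ℓ ^ n)⁻¹ * ∫ x in cube n c₁ ℓ ×ˢ cube n c₂ ℓ, f x := fun f => by
    simp only [μ]
    rw [Measure.prod_smul_left, Measure.prod_smul_right, Measure.prod_restrict,
      integral_smul_measure, integral_smul_measure, ENNReal.toReal_inv, ENNReal.toReal_ofReal hV.le, smul_eq_mul, smul_eq_mul, mul_assoc]
    rfl
  have := hpr c₁
  have := hpr c₂
  have h := tri n (μ c₁) (μ c₂) u hu Λ hΛ m₁ m₂ p η hη hηp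
  rw [hI, hI, hI2, hI2] at h
  exact h


theorem Ufun_nonneg (n : ℕ) (s ε : ℝ) (u : En n → ℝ) (z : En n × En n) : 0 ≤ Ufun n s ε u z := by
  unfold Ufun; positivity

theorem U_le_G (n : ℕ) (p q s t ε : ℝ) (a : En n × En n → ℝ) (ha : ∀ z, 0 ≤ a z) (u : En n → ℝ)
    (z : En n × En n) : Ufun n s ε u z ^ p ≤ Gfun n p q s t ε a u z := by
  have h1 := Ufun_nonneg n s ε u z
  have h2 := ha z
  have : 0 ≤ Afun n p q s t ε a z := by unfold Afun; positivity
  unfold Gfun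
  have : 0 ≤ Afun n p q s t ε a z * Ufun n s ε u z ^ q := by positivity
  linarith

/-- comparison constant for `G` and `U^p` -/
def CG (p q s t M Λ R : ℝ) : ℝ := 1 + |M| * (2 * |Λ|) ^ (q - p) * R ^ (s * p - t * q)

theorem G_le_U (n : ℕ) (p q s t ε M Λ R : ℝ) (hp : 2 ≤ p) (hpq : p ≤ q) (hst : t * q ≤ s * p)
    (a : En n × En n → ℝ) (ha : ∀ z, 0 ≤ a z) (haM : ∀ z, a z ≤ M) (u : En n → ℝ)
    (hΛ : ∀ x, |u x| ≤ Λ)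
    (z : En n × En n) (hz : ‖z.1 - z.2‖ ≤ R) :
    Gfun n p q s t ε a u z ≤ CG p q s t M Λ R * Ufun n s ε u z ^ p := by
  have hp0 : p ≠ 0 := by linarith
  have hq0 : q ≠ 0 := by linarith
  have hM : 0 ≤ M := (ha z).trans (haM z)
  have hL : 0 ≤ Λ := (abs_nonneg _).trans (hΛ z.1)
  unfold Gfun CG
  by_cases h0 : u z.1 - u z.2 = 0
  · have : Ufun n s ε u z = 0 := by simp [Ufun, h0]
    rw [this, Real.zero_rpow hp0, Real.zero_rpow hq0]; simp
  have hne : z.1 - z.2 ≠ 0 := by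
    intro h
    rw [sub_eq_zero.1 h] at h0
    simp at h0
  have hρ : 0 < ‖z.1 - z.2‖ := norm_pos_iff.2 hne
  have hΔ : 0 < |u z.1 - u z.2| := abs_pos.2 h0
  have hbd : |u z.1 - u z.2| ≤ 2 * |Λ| := by
    have := hΛ z.1; have := hΛ z.2
    have h3 : |u z.1 - u z.2| ≤ |u z.1| + |u z.2| := by simpa using abs_sub_le (u z.1) 0 (u z.2)
    rw [abs_of_nonneg hL]
    linarith
  have e : Afun n p q s t ε a z * Ufun n s ε u z ^ q =
      (a z * |u z.1 - u z.2| ^ (q - p) * ‖z.1 - z.2‖ ^ (s * p - t * q)) * Ufun n s ε u z ^ p := by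
    unfold Afun Ufun
    rw [Real.div_rpow hΔ.le (by positivity), Real.div_rpow hΔ.le (by positivity), ← Real.rpow_mul hρ.le,
      ← Real.rpow_mul hρ.le, Real.rpow_sub hΔ]
    have e1 : ‖z.1 - z.2‖ ^ ((s - t) * q + ε * (q - p)) =
       ‖z.1 - z.2‖ ^ ((s + ε) * q) * ‖z.1 - z.2‖ ^ (s * p - t * q) / ‖z.1 - z.2‖ ^ ((s + ε) * p) := by
      rw [← Real.rpow_add hρ, ← Real.rpow_sub hρ]; congr 1; ring
    rw [e1]
    field_simp
  rw [e, add_mul, one_mul]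
  have hU := Ufun_nonneg n s ε u z
  have := haM z
  have := ha z
  rw [abs_of_nonneg hM]
  have k1 : |u z.1 - u z.2| ^ (q - p) ≤ (2 * |Λ|) ^ (q - p) :=
    Real.rpow_le_rpow hΔ.le hbd (by linarith)
  have k2 : ‖z.1 - z.2‖ ^ (s * p - t * q) ≤ R ^ (s * p - t * q) :=
    Real.rpow_le_rpow hρ.le hz (by linarith)
  gcongr

theorem H_pC (n : ℕ) (p q s t ε : ℝ) (hp : 2 ≤ p) (a : En n × En n → ℝ) (ha : ∀ z, 0 ≤ a z)
    (u : En n → ℝ) (z : En n × En n) :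
    Hfun n p q s t ε a u z ^ pC p = Gfun n p q s t ε a u z := by
  have hG : 0 ≤ Gfun n p q s t ε a u z :=
    (Real.rpow_nonneg (Ufun_nonneg n s ε u z) p).trans (U_le_G n p q s t ε a ha u z)
  unfold Hfun pC
  rw [← Real.rpow_mul hG]
  have : (p - 1) / p * (p / (p - 1)) = 1 := by
    have : p - 1 ≠ 0 := by linarith
    field_simp
  rw [this, Real.rpow_one]

theorem gamma_eq (n : ℕ) (p s ε : ℝ) : gammaEx n p s ε = etaEx n p s ε / (p - 1) := by
  unfold gammaEx etaEx pC
  rw [div_mul_div_comm, div_div]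
  congr 1 <;> ring

theorem H_gamma (n : ℕ) (p q s t ε : ℝ) (hp : 2 ≤ p) (a : En n × En n → ℝ) (ha : ∀ z, 0 ≤ a z)
    (u : En n → ℝ) (z : En n × En n) :
    Hfun n p q s t ε a u z ^ gammaEx n p s ε = Gfun n p q s t ε a u z ^ (etaEx n p s ε / p) := by
  have hG : 0 ≤ Gfun n p q s t ε a u z :=
    (Real.rpow_nonneg (Ufun_nonneg n s ε u z) p).trans (U_le_G n p q s t ε a ha u z)
  unfold Hfun
  rw [← Real.rpow_mul hG, gamma_eq n p s ε]
  congr 1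
  have : p - 1 ≠ 0 := by linarith
  field_simp

theorem U_le_H (n : ℕ) (p q s t ε : ℝ) (hp : 2 ≤ p) (a : En n × En n → ℝ) (ha : ∀ z, 0 ≤ a z)
    (u : En n → ℝ) (z : En n × En n) (hη : 0 ≤ etaEx n p s ε) :
    Ufun n s ε u z ^ etaEx n p s ε ≤ Hfun n p q s t ε a u z ^ gammaEx n p s ε := by
  rw [H_gamma n p q s t ε hp a ha]
  have hU := Ufun_nonneg n s ε u z
  have := Real.rpow_le_rpow (by positivity) (U_le_G n p q s t ε a ha u z)
    (by positivity : 0 ≤ etaEx n p s ε / p)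
  rw [← Real.rpow_mul hU] at this
  have e : p * (etaEx n p s ε / p) = etaEx n p s ε := by field_simp
  rwa [e] at this

theorem H_le (n : ℕ) (p q s t ε M Λ R : ℝ) (hp : 2 ≤ p) (hpq : p ≤ q) (hst : t * q ≤ s * p)
    (hR : 0 ≤ R)
    (a : En n × En n → ℝ) (ha : ∀ z, 0 ≤ a z) (haM : ∀ z, a z ≤ M) (u : En n → ℝ)
    (hΛ : ∀ x, |u x| ≤ Λ) (hη : 0 ≤ etaEx n p s ε) (hηp : etaEx n p s ε ≤ p)
    (z : En n × En n) (hz : ‖z.1 - z.2‖ ≤ R) :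
    Hfun n p q s t ε a u z ^ gammaEx n p s ε ≤ CG p q s t M Λ R * (1 + Ufun n s ε u z ^ p) := by
  rw [H_gamma n p q s t ε hp a ha]
  have hU := Ufun_nonneg n s ε u z
  have hG : 0 ≤ Gfun n p q s t ε a u z :=
    (Real.rpow_nonneg hU p).trans (U_le_G n p q s t ε a ha u z)
  have h := G_le_U n p q s t ε M Λ R hp hpq hst a ha haM u hΛ z hz
  have hC : 1 ≤ CG p q s t M Λ R := by
    unfold CG
    have : 0 ≤ |M| * (2 * |Λ|) ^ (q - p) * R ^ (s * p - t * q) := by positivity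
    linarith
  have : Gfun n p q s t ε a u z ^ (etaEx n p s ε / p) ≤ 1 + Gfun n p q s t ε a u z := by
    rcases le_total (Gfun n p q s t ε a u z) 1 with h1 | h1
    · have := Real.rpow_le_one hG h1 (by positivity : 0 ≤ etaEx n p s ε / p)
      linarith
    · have := Real.rpow_le_rpow_of_exponent_le h1 (show etaEx n p s ε / p ≤ 1 by
        rw [div_le_one (by linarith)]; exact hηp)
      rw [Real.rpow_one] at this; linarith
  nlinarith

theorem U_J (n : ℕ) (p s ε η κ : ℝ) (hη : 0 < η) (hκ : κ = n - ε * p + (s + ε) * η) (u : En n → ℝ)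
    (x y : En n) :
    ‖x - y‖ ^ (ε * p - n) * Ufun n s ε u (x, y) ^ η = Jk n η κ u x y := by
  unfold Ufun Jk
  by_cases h0 : x = y
  · subst h0; simp [Real.zero_rpow hη.ne']
  have hρ : 0 < ‖x - y‖ := norm_pos_iff.2 (sub_ne_zero.2 h0)
  simp only
  rw [Real.div_rpow (abs_nonneg _) (by positivity), ← Real.rpow_mul hρ.le, div_eq_mul_inv,
    ← Real.rpow_neg hρ.le, mul_left_comm, ← Real.rpow_add hρ]
  congr 2
  rw [hκ]; ring

theorem U_p (n : ℕ) (p s ε : ℝ) (hp : 2 ≤ p) (u : En n → ℝ) (z : En n × En n) :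
    ‖z.1 - z.2‖ ^ (ε * p - n) * Ufun n s ε u z ^ p =
      |u z.1 - u z.2| ^ p / ‖z.1 - z.2‖ ^ ((n : ℝ) + s * p) := by
  have h := U_J n p s ε p (n + s * p) (by linarith) (by ring) u z.1 z.2
  rw [Prod.mk.eta] at h
  rw [h]
  unfold Jk
  rw [Real.rpow_neg (norm_nonneg _), div_eq_mul_inv]


theorem Ufun_meas (n : ℕ) (s ε : ℝ) (u : En n → ℝ) (hu : Measurable u) :
    Measurable (Ufun n s ε u) := by
  unfold Ufun; fun_prop

theorem Gfun_meas (n : ℕ) (p q s t ε : ℝ) (a : En n × En n → ℝ) (ham : Measurable a) (u : En n → ℝ)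
    (hu : Measurable u) : Measurable (Gfun n p q s t ε a u) := by
  have := Ufun_meas n s ε u hu
  unfold Gfun Afun; fun_prop

theorem Hg_meas (n : ℕ) (p q s t ε : ℝ) (a : En n × En n → ℝ) (ham : Measurable a) (u : En n → ℝ)
    (hu : Measurable u) (γ : ℝ) : Measurable (fun z => Hfun n p q s t ε a u z ^ γ) := by
  have := Gfun_meas n p q s t ε a ham u hu
  unfold Hfun; fun_prop

theorem w_meas (n : ℕ) (b : ℝ) :
    Measurable (fun z : En n × En n => ENNReal.ofReal (‖z.1 - z.2‖ ^ b)) := by fun_prop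

theorem nu_lint (n : ℕ) (p ε : ℝ) (S : Set (En n × En n)) (hS : MeasurableSet S) (f : En n × En n → ℝ)
    (hf : Measurable f) :
    ∫⁻ z in S, ENNReal.ofReal (f z) ∂nu n p ε =
      ∫⁻ z in S, ENNReal.ofReal (‖z.1 - z.2‖ ^ (ε * p - n) * f z) := by
  unfold nu
  rw [setLIntegral_withDensity_eq_setLIntegral_mul _ (w_meas n _) hf.ennreal_ofReal hS]
  congr 1
  ext z
  rw [Pi.mul_apply, ← ENNReal.ofReal_mul (by positivity)]

theorem Hg_nonneg (n : ℕ) (p q s t ε : ℝ) (a : En n × En n → ℝ) (ha : ∀ z, 0 ≤ a z) (u : En n → ℝ)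
    (γ : ℝ) (z : En n × En n) : 0 ≤ Hfun n p q s t ε a u z ^ γ := by
  have hG : 0 ≤ Gfun n p q s t ε a u z :=
    (Real.rpow_nonneg (Ufun_nonneg n s ε u z) p).trans (U_le_G n p q s t ε a ha u z)
  unfold Hfun; positivity

theorem H_intOn (n : ℕ) (p q s t ε M Λ R : ℝ) (hp : 2 ≤ p) (hpq : p ≤ q) (hst : t * q ≤ s * p)
    (hR : 0 ≤ R)
    (a : En n × En n → ℝ) (ham : Measurable a) (ha : ∀ z, 0 ≤ a z) (haM : ∀ z, a z ≤ M) (u : En n → ℝ)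
    (hu : MemWsp n s p u)
    (hΛ : ∀ x, |u x| ≤ Λ) (hη : 0 ≤ etaEx n p s ε) (hηp : etaEx n p s ε ≤ p)
    (S : Set (En n × En n)) (hS : MeasurableSet S) (hSR : ∀ z ∈ S, ‖z.1 - z.2‖ ≤ R)
    (hfin : nu n p ε S < ⊤) :
    IntegrableOn (fun z => Hfun n p q s t ε a u z ^ gammaEx n p s ε) S (nu n p ε) := by
  obtain ⟨hum, -, hE⟩ := hu
  have hUm := Ufun_meas n s ε u hum
  have hUp : IntegrableOn (fun z => Ufun n s ε u z ^ p) S (nu n p ε) := by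
    refine ⟨(hUm.pow_const p).aestronglyMeasurable, ?_⟩
    rw [hasFiniteIntegral_iff_ofReal (Filter.Eventually.of_forall fun z => Real.rpow_nonneg (Ufun_nonneg n s ε u z) p),
      nu_lint n p ε S hS _ (hUm.pow_const p)]
    simp only [U_p n p s ε hp]
    exact (setLIntegral_le_lintegral _ _).trans_lt hE
  have hb : IntegrableOn (fun z => CG p q s t M Λ R * (1 + Ufun n s ε u z ^ p)) S (nu n p ε) :=
    ((integrableOn_const hfin.ne).add hUp).const_mul _
  refine Integrable.mono' hb (Hg_meas n p q s t ε a ham u hum _).aestronglyMeasurable ?_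
  refine (ae_restrict_iff' hS).2 (Filter.Eventually.of_forall fun z hz => ?_)
  rw [Real.norm_eq_abs, abs_of_nonneg (Hg_nonneg n p q s t ε a ha u _ z)]
  exact H_le n p q s t ε M Λ R hp hpq hst hR a ha haM u hΛ hη hηp z (hSR z hz)

/-- constant for the measure of diagonal cubes -/
def CE (n : ℕ) : ℝ := n * volume.real (ball (0 : En n) 1) * (2 * Real.sqrt n)

theorem nu_diag (n : ℕ) (hn : 2 ≤ n) (p ε : ℝ) (hp : 2 ≤ p) (hε : 0 < ε) (hεp : ε * p ≤ 1) (c : En n) (ℓ : ℝ)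
    (hℓ : 0 < ℓ) :
    nu n p ε (cube n c ℓ ×ˢ cube n c ℓ) ≤ ENNReal.ofReal (CE n * (ℓ ^ (n + ε * p) / ε)) := by
  have hm := cube_meas n c ℓ
  unfold nu
  rw [withDensity_apply _ (hm.prod hm), Measure.volume_eq_prod, setLIntegral_prod _ (w_meas n _).aemeasurable]
  have hCE : 0 ≤ CE n := by unfold CE; positivity
  calc ∫⁻ x in cube n c ℓ, ∫⁻ y in cube n c ℓ, ENNReal.ofReal (‖x - y‖ ^ (ε * p - n))
      ≤ ∫⁻ x in cube n c ℓ, ENNReal.ofReal (CE n * (ℓ ^ (ε * p) / (ε * p))) := by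
        apply setLIntegral_mono' hm
        intro x hx
        exact cube_kernel n hn (ε * p) (by positivity) hεp c ℓ hℓ x hx
    _ = ENNReal.ofReal (CE n * (ℓ ^ (ε * p) / (ε * p)) * ℓ ^ n) := by
        rw [setLIntegral_const, cube_vol, ← ENNReal.ofReal_pow hℓ.le, ← ENNReal.ofReal_mul (by positivity)]
    _ ≤ _ := by
        apply ENNReal.ofReal_le_ofReal
        rw [Real.rpow_add hℓ, Real.rpow_natCast]
        have : ℓ ^ (ε * p) / (ε * p) ≤ ℓ ^ (ε * p) / ε := by
          apply div_le_div_of_nonneg_left (by positivity) hε; nlinarith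
        calc CE n * (ℓ ^ (ε * p) / (ε * p)) * ℓ ^ n ≤ CE n * (ℓ ^ (ε * p) / ε) * ℓ ^ n := by gcongr
          _ = _ := by ring

theorem diag_est (n : ℕ) (hn : 2 ≤ n) (p q s t ε M Λ R κ : ℝ) (hp : 2 ≤ p) (hpq : p ≤ q) (hst : t * q ≤ s * p)
    (hR : 0 ≤ R) (hε : 0 < ε) (hεp : ε * p ≤ 1)
    (a : En n × En n → ℝ) (ham : Measurable a) (ha : ∀ z, 0 ≤ a z) (haM : ∀ z, a z ≤ M) (u : En n → ℝ)
    (hu : MemWsp n s p u)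
    (hΛ : ∀ x, |u x| ≤ Λ) (hη : 1 ≤ etaEx n p s ε) (hηp : etaEx n p s ε < p)
    (hκ : κ = n - ε * p + (s + ε) * etaEx n p s ε) (hnκ : n < κ)
    (hcrit : n * (etaEx n p s ε / p) = 2 * n - κ)
    (c : En n) (ℓ : ℝ) (hℓ : 0 < ℓ) (hℓR : Real.sqrt n * ℓ ≤ R) (m : ℝ)
    (hm : m = ⨍ y in cube n c ℓ, u y) :
    (∫ y in cube n c ℓ, |u y - m| ^ p) ^ (etaEx n p s ε / p) ≤
      Csob n p * (CE n * (ℓ ^ (n + ε * p) / ε) *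
        ⨍ z in cube n c ℓ ×ˢ cube n c ℓ, Hfun n p q s t ε a u z ^ gammaEx n p s ε ∂nu n p ε) := by
  set η := etaEx n p s ε with hηd
  have hη0 : 0 < η := by linarith
  have hum := hu.1
  have hKm := cube_meas n c ℓ
  have hKK := hKm.prod hKm
  have hC : 0 ≤ Csob n p := by unfold Csob; positivity
  have hCE : 0 ≤ CE n := by unfold CE; positivity
  have hν := nu_diag n hn p ε hp hε hεp c ℓ hℓ
  have hνfin : nu n p ε (cube n c ℓ ×ˢ cube n c ℓ) < ⊤ := hν.trans_lt ENNReal.ofReal_lt_top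
  have hInt := H_intOn n p q s t ε M Λ R hp hpq hst hR a ham ha haM u hu hΛ hη0.le hηp.le _ hKK
    (fun z hz => (cube_norm_le n c ℓ hℓ.le z.1 z.2 hz.1 hz.2).trans hℓR) hνfin
  set F := ⨍ z in cube n c ℓ ×ˢ cube n c ℓ, Hfun n p q s t ε a u z ^ gammaEx n p s ε ∂nu n p ε with hF
  have hF0 : 0 ≤ F := by
    rw [hF, setAverage_eq, smul_eq_mul]
    exact mul_nonneg (by positivity) (integral_nonneg fun z => Hg_nonneg n p q s t ε a ha u _ z)
  have hS := sobolev n hn p η κ hη hηp hnκ hcrit u hum Λ hΛ c ℓ m hℓ hm _ rfl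
  have hE : ∫⁻ x in cube n c ℓ, ∫⁻ y in cube n c ℓ, ENNReal.ofReal (Jk n η κ u x y) ≤
      ENNReal.ofReal (CE n * (ℓ ^ (n + ε * p) / ε) * F) := by
    have hUm := (Ufun_meas n s ε u hum).pow_const η
    calc ∫⁻ x in cube n c ℓ, ∫⁻ y in cube n c ℓ, ENNReal.ofReal (Jk n η κ u x y)
        = ∫⁻ z in cube n c ℓ ×ˢ cube n c ℓ, ENNReal.ofReal (Ufun n s ε u z ^ η) ∂nu n p ε := by
          rw [nu_lint n p ε _ hKK _ hUm, Measure.volume_eq_prod, setLIntegral_prod]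
          · simp only [U_J n p s ε η κ hη0 hκ]
          · have : Measurable (fun z : En n × En n => ENNReal.ofReal (‖z.1 - z.2‖ ^ (ε * p - n) * Ufun n s ε u z ^ η)) := by
              have h1 : Measurable (fun z : En n × En n => ‖z.1 - z.2‖ ^ (ε * p - n)) := by fun_prop
              exact (h1.mul hUm).ennreal_ofReal
            exact this.aemeasurable
      _ ≤ ∫⁻ z in cube n c ℓ ×ˢ cube n c ℓ, ENNReal.ofReal (Hfun n p q s t ε a u z ^ gammaEx n p s ε) ∂nu n p ε := by
          apply lintegral_mono
          intro z
          exact ENNReal.ofReal_le_ofReal (U_le_H n p q s t ε hp a ha u z hη0.le)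
      _ = ENNReal.ofReal (∫ z in cube n c ℓ ×ˢ cube n c ℓ, Hfun n p q s t ε a u z ^ gammaEx n p s ε ∂nu n p ε) := by
          rw [ofReal_integral_eq_lintegral_ofReal hInt (Filter.Eventually.of_forall fun z => Hg_nonneg n p q s t ε a ha u _ z)]
      _ ≤ _ := by
          apply ENNReal.ofReal_le_ofReal
          rw [← measure_smul_setAverage _ hνfin.ne, smul_eq_mul]
          refine mul_le_mul_of_nonneg_right ?_ hF0
          exact ENNReal.toReal_le_of_le_ofReal (by positivity) hν
  have h3 := hS.trans (mul_le_mul_right hE _)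
  rw [← ENNReal.ofReal_mul hC, ENNReal.ofReal_le_ofReal_iff (by positivity)] at h3
  exact h3


theorem wd_int {α : Type*} [MeasurableSpace α] (μ : Measure α) (w : α → ℝ) (hw : Measurable w)
    (S : Set α) (hS : MeasurableSet S) (hw0 : ∀ z ∈ S, 0 ≤ w z) (f : α → ℝ) :
    ∫ z in S, f z ∂(μ.withDensity fun z => ENNReal.ofReal (w z)) = ∫ z in S, w z * f z ∂μ := by
  rw [setIntegral_withDensity_eq_setIntegral_toReal_smul (by fun_prop) (by simp) f hS]
  apply setIntegral_congr_fun hS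
  intro z hz
  simp [ENNReal.toReal_ofReal (hw0 z hz)]

theorem wd_real {α : Type*} [MeasurableSpace α] (μ : Measure α) (w : α → ℝ) (hw : Measurable w)
    (S : Set α) (hS : MeasurableSet S) (hμ : μ S < ⊤) (w0 w1 : ℝ) (h0 : 0 < w0)
    (hw0 : ∀ z ∈ S, w0 ≤ w z) (hw1 : ∀ z ∈ S, w z ≤ w1) (h01 : w0 ≤ w1) :
    (μ.withDensity fun z => ENNReal.ofReal (w z)) S < ⊤ ∧
    w0 * μ.real S ≤ (μ.withDensity fun z => ENNReal.ofReal (w z)).real S ∧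
    (μ.withDensity fun z => ENNReal.ofReal (w z)).real S ≤ w1 * μ.real S := by
  have hu : (μ.withDensity fun z => ENNReal.ofReal (w z)) S ≤ ENNReal.ofReal w1 * μ S := by
    rw [withDensity_apply _ hS, ← setLIntegral_const]
    exact setLIntegral_mono' hS fun z hz => ENNReal.ofReal_le_ofReal (hw1 z hz)
  have hl : ENNReal.ofReal w0 * μ S ≤ (μ.withDensity fun z => ENNReal.ofReal (w z)) S := by
    rw [withDensity_apply _ hS, ← setLIntegral_const]
    exact setLIntegral_mono' hS fun z hz => ENNReal.ofReal_le_ofReal (hw0 z hz)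
  have ht : ENNReal.ofReal w1 * μ S < ⊤ := ENNReal.mul_lt_top ENNReal.ofReal_lt_top hμ
  refine ⟨hu.trans_lt ht, ?_, ?_⟩
  · have := ENNReal.toReal_mono (hu.trans_lt ht).ne hl
    rwa [ENNReal.toReal_mul, ENNReal.toReal_ofReal h0.le] at this
  · have := ENNReal.toReal_mono ht.ne hu
    rwa [ENNReal.toReal_mul, ENNReal.toReal_ofReal (h0.le.trans h01)] at this

theorem wd_upper {α : Type*} [MeasurableSpace α] (μ : Measure α) (w : α → ℝ) (hw : Measurable w)
    (S : Set α) (hS : MeasurableSet S) (hμ : μ S < ⊤) (hV : 0 < μ.real S) (w0 w1 K : ℝ) (h0 : 0 < w0)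
    (hw0 : ∀ z ∈ S, w0 ≤ w z) (hw1 : ∀ z ∈ S, w z ≤ w1) (h01 : w0 ≤ w1) (hK : w1 ≤ K * w0)
    (f g : α → ℝ) (hf : ∀ z ∈ S, 0 ≤ f z) (hfg : ∀ z ∈ S, f z ≤ g z) (hg : IntegrableOn g S μ) :
    ⨍ z in S, f z ∂(μ.withDensity fun z => ENNReal.ofReal (w z)) ≤ K * ((μ.real S)⁻¹ * ∫ z in S, g z ∂μ) := by
  obtain ⟨hfin, hlo, hhi⟩ := wd_real μ w hw S hS hμ w0 w1 h0 hw0 hw1 h01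
  have hI : ∫ z in S, w z * f z ∂μ ≤ w1 * ∫ z in S, g z ∂μ := by
    rw [← integral_const_mul]
    refine integral_mono_of_nonneg ?_ (hg.const_mul _) ?_
    · exact (ae_restrict_iff' hS).2 (Filter.Eventually.of_forall fun z hz =>
        mul_nonneg (h0.le.trans (hw0 z hz)) (hf z hz))
    · exact (ae_restrict_iff' hS).2 (Filter.Eventually.of_forall fun z hz =>
        mul_le_mul (hw1 z hz) (hfg z hz) (hf z hz) (h0.le.trans h01))
  have hg0 : 0 ≤ ∫ z in S, g z ∂μ := setIntegral_nonneg hS fun z hz => (hf z hz).trans (hfg z hz)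
  rw [setAverage_eq, smul_eq_mul, wd_int μ w hw S hS (fun z hz => h0.le.trans (hw0 z hz))]
  have hwV : 0 < w0 * μ.real S := by positivity
  have hν := hwV.trans_le hlo
  rw [inv_mul_le_iff₀ hν]
  refine hI.trans ?_
  have hK0 : 0 ≤ K := by
    by_contra h
    push Not at h
    nlinarith
  calc w1 * ∫ z in S, g z ∂μ ≤ K * w0 * ∫ z in S, g z ∂μ := by gcongr
    _ = (w0 * μ.real S) * (K * ((μ.real S)⁻¹ * ∫ z in S, g z ∂μ)) := by field_simp
    _ ≤ _ := by gcongr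

theorem wd_lower {α : Type*} [MeasurableSpace α] (μ : Measure α) (w : α → ℝ) (hw : Measurable w)
    (S : Set α) (hS : MeasurableSet S) (hμ : μ S < ⊤) (hV : 0 < μ.real S) (w0 w1 K : ℝ) (h0 : 0 < w0)
    (hw0 : ∀ z ∈ S, w0 ≤ w z) (hw1 : ∀ z ∈ S, w z ≤ w1) (h01 : w0 ≤ w1) (hK : w1 ≤ K * w0)
    (f g : α → ℝ) (hg : ∀ z ∈ S, 0 ≤ g z) (hfg : ∀ z ∈ S, g z ≤ f z)
    (hf : IntegrableOn f S (μ.withDensity fun z => ENNReal.ofReal (w z))) :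
    (μ.real S)⁻¹ * ∫ z in S, g z ∂μ ≤ K * ⨍ z in S, f z ∂(μ.withDensity fun z => ENNReal.ofReal (w z)) := by
  obtain ⟨hfin, hlo, hhi⟩ := wd_real μ w hw S hS hμ w0 w1 h0 hw0 hw1 h01
  have hwf : IntegrableOn (fun z => w z * f z) S μ := by
    unfold IntegrableOn at hf
    rw [restrict_withDensity hS, integrable_withDensity_iff_integrable_smul' (by fun_prop) (by simp)] at hf
    refine IntegrableOn.congr_fun (f := fun z => (ENNReal.ofReal (w z)).toReal • f z) hf ?_ hS
    intro z hz
    simp [ENNReal.toReal_ofReal (h0.le.trans (hw0 z hz))]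
  have hI : w0 * ∫ z in S, g z ∂μ ≤ ∫ z in S, w z * f z ∂μ := by
    rw [← integral_const_mul]
    refine integral_mono_of_nonneg ?_ hwf ?_
    · exact (ae_restrict_iff' hS).2 (Filter.Eventually.of_forall fun z hz =>
        mul_nonneg h0.le (hg z hz))
    · exact (ae_restrict_iff' hS).2 (Filter.Eventually.of_forall fun z hz =>
        mul_le_mul (hw0 z hz) (hfg z hz) (hg z hz) (h0.le.trans (hw0 z hz)))
  rw [← wd_int μ w hw S hS (fun z hz => h0.le.trans (hw0 z hz)), ← measure_smul_setAverage _ hfin.ne,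
    smul_eq_mul] at hI
  set F := ⨍ z in S, f z ∂(μ.withDensity fun z => ENNReal.ofReal (w z)) with hF
  have hF0 : 0 ≤ F := by
    rw [hF, setAverage_eq, smul_eq_mul]
    exact mul_nonneg (by positivity) (setIntegral_nonneg hS fun z hz => (hg z hz).trans (hfg z hz))
  rw [inv_mul_le_iff₀ hV]
  refine le_of_mul_le_mul_left (hI.trans ?_) h0
  calc _ ≤ w1 * μ.real S * F := mul_le_mul_of_nonneg_right hhi hF0
    _ ≤ K * w0 * μ.real S * F := by gcongr
    _ = _ := by ring

theorem setDist_bounds (n : ℕ) (c₁ c₂ : En n) (ℓ : ℝ) (hℓ : 0 < ℓ) (x y : En n) (hx : x ∈ cube n c₁ ℓ)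
    (hy : y ∈ cube n c₂ ℓ) :
    setDistE (cube n c₁ ℓ) (cube n c₂ ℓ) ≤ ‖x - y‖ ∧
    ‖x - y‖ ≤ setDistE (cube n c₁ ℓ) (cube n c₂ ℓ) + 2 * Real.sqrt n * ℓ := by
  unfold setDistE
  constructor
  · rw [← dist_eq_norm]
    refine csInf_le ⟨0, ?_⟩ (mem_image2_of_mem hx hy)
    rintro _ ⟨a, -, b, -, rfl⟩
    exact dist_nonneg
  · rw [← sub_le_iff_le_add]
    refine le_csInf ⟨_, mem_image2_of_mem hx hy⟩ ?_
    rintro _ ⟨a, ha, b, hb, rfl⟩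
    have h1 := cube_norm_le n c₁ ℓ hℓ.le x a hx ha
    have h2 := cube_norm_le n c₂ ℓ hℓ.le b y hb hy
    rw [dist_eq_norm]
    have : x - y = (x - a) + (a - b) + (b - y) := by abel
    have h3 : ‖x - y‖ ≤ ‖x - a‖ + ‖a - b‖ + ‖b - y‖ := by rw [this]; exact norm_add₃_le
    linarith

theorem prod_volr (n : ℕ) (c₁ c₂ : En n) (ℓ : ℝ) (hℓ : 0 ≤ ℓ) :
    volume (cube n c₁ ℓ ×ˢ cube n c₂ ℓ) < ⊤ ∧
    volume.real (cube n c₁ ℓ ×ˢ cube n c₂ ℓ) = ℓ ^ n * ℓ ^ n := by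
  rw [Measure.real, Measure.volume_eq_prod, Measure.prod_prod, cube_vol, cube_vol]
  constructor
  · exact ENNReal.mul_lt_top (ENNReal.pow_lt_top ENNReal.ofReal_lt_top) (ENNReal.pow_lt_top ENNReal.ofReal_lt_top)
  · rw [ENNReal.toReal_mul, ENNReal.toReal_pow, ENNReal.toReal_ofReal hℓ]


/-- distance distortion constant -/
def cD (n : ℕ) : ℝ := 1 + 2 * Real.sqrt n

theorem cD_one (n : ℕ) : 1 ≤ cD n := by
  unfold cD; have := Real.sqrt_nonneg n; linarith

theorem rho_bounds (n : ℕ) (c₁ c₂ : En n) (ℓ d : ℝ) (hℓ : 0 < ℓ)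
    (hd : d = setDistE (cube n c₁ ℓ) (cube n c₂ ℓ)) (hℓd : ℓ ≤ d) (z : En n × En n)
    (hz : z ∈ cube n c₁ ℓ ×ˢ cube n c₂ ℓ) : d ≤ ‖z.1 - z.2‖ ∧ ‖z.1 - z.2‖ ≤ cD n * d := by
  obtain ⟨h1, h2⟩ := setDist_bounds n c₁ c₂ ℓ hℓ z.1 z.2 hz.1 hz.2
  rw [← hd] at h1 h2
  refine ⟨h1, h2.trans ?_⟩
  unfold cD
  have := mul_le_mul_of_nonneg_left hℓd (by positivity : 0 ≤ 2 * Real.sqrt n)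
  linarith

theorem weight_facts (n : ℕ) (p ε d c : ℝ) (hc : 1 ≤ c) (hd : 0 < d) (hεp0 : 0 ≤ ε * p) (hεp : ε * p ≤ n) :
    0 < (c * d) ^ (ε * p - n) ∧ (∀ ρ, d ≤ ρ → ρ ≤ c * d → (c * d) ^ (ε * p - n) ≤ ρ ^ (ε * p - n) ∧
      ρ ^ (ε * p - n) ≤ d ^ (ε * p - n)) ∧ (c * d) ^ (ε * p - n) ≤ d ^ (ε * p - n) ∧
      d ^ (ε * p - n) ≤ c ^ n * (c * d) ^ (ε * p - n) := by
  have hc0 : 0 < c := by linarith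
  have hcd : d ≤ c * d := by nlinarith
  have hA : ∀ ρ, d ≤ ρ → ρ ≤ c * d → (c * d) ^ (ε * p - n) ≤ ρ ^ (ε * p - n) ∧
      ρ ^ (ε * p - n) ≤ d ^ (ε * p - n) := by
    intro ρ h1 h2
    exact ⟨Real.rpow_le_rpow_of_nonpos (hd.trans_le h1) h2 (by linarith),
      Real.rpow_le_rpow_of_nonpos hd h1 (by linarith)⟩
  refine ⟨by positivity, hA, (hA d le_rfl hcd).1, ?_⟩
  rw [Real.mul_rpow hc0.le hd.le, ← mul_assoc, ← Real.rpow_natCast, ← Real.rpow_add hc0]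
  have : 1 ≤ c ^ ((n : ℝ) + (ε * p - n)) := Real.one_le_rpow hc (by linarith)
  exact le_mul_of_one_le_left (by positivity) this

theorem off_upper (n : ℕ) (p q s t ε M Λ R : ℝ) (hp : 2 ≤ p) (hpq : p ≤ q) (hst : t * q ≤ s * p)
    (hsε : 0 ≤ s + ε) (hεp0 : 0 ≤ ε * p) (hεp : ε * p ≤ n)
    (a : En n × En n → ℝ) (ha : ∀ z, 0 ≤ a z) (haM : ∀ z, a z ≤ M) (u : En n → ℝ)
    (hu : Measurable u) (hΛ : ∀ x, |u x| ≤ Λ) (c₁ c₂ : En n) (ℓ d : ℝ) (hℓ : 0 < ℓ)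
    (hd : d = setDistE (cube n c₁ ℓ) (cube n c₂ ℓ)) (hℓd : ℓ ≤ d) (hR : cD n * d ≤ R) (hR0 : 0 ≤ R) :
    ⨍ z in cube n c₁ ℓ ×ˢ cube n c₂ ℓ, Hfun n p q s t ε a u z ^ pC p ∂nu n p ε ≤
      cD n ^ n * (CG p q s t M Λ R / (d ^ (s + ε)) ^ p *
        ((ℓ ^ n)⁻¹ * (ℓ ^ n)⁻¹ * ∫ z in cube n c₁ ℓ ×ˢ cube n c₂ ℓ, |u z.1 - u z.2| ^ p)) := by
  have hd0 : 0 < d := hℓ.trans_le hℓd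
  obtain ⟨w0, w1, w2, w3⟩ := weight_facts n p ε d (cD n) (cD_one n) hd0 hεp0 hεp
  obtain ⟨v1, v2⟩ := prod_volr n c₁ c₂ ℓ hℓ.le
  have hρ := rho_bounds n c₁ c₂ ℓ d hℓ hd hℓd
  have hS := (cube_meas n c₁ ℓ).prod (cube_meas n c₂ ℓ)
  have hCG : 0 ≤ CG p q s t M Λ R := by unfold CG; positivity
  have hw : Measurable (fun z : En n × En n => ‖z.1 - z.2‖ ^ (ε * p - n)) := by fun_prop
  have hIntg : IntegrableOn (fun z : En n × En n => |u z.1 - u z.2| ^ p) (cube n c₁ ℓ ×ˢ cube n c₂ ℓ) := by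
    apply Measure.integrableOn_of_bounded (M := (2 * Λ) ^ p) v1.ne
    · have : Measurable (fun z : En n × En n => |u z.1 - u z.2| ^ p) := by fun_prop
      exact this.aestronglyMeasurable
    · refine Filter.Eventually.of_forall fun z => ?_
      rw [Real.norm_eq_abs, abs_of_nonneg (by positivity)]
      apply Real.rpow_le_rpow (abs_nonneg _) _ (by linarith)
      have := hΛ z.1; have := hΛ z.2
      have h3 : |u z.1 - u z.2| ≤ |u z.1| + |u z.2| := by simpa using abs_sub_le (u z.1) 0 (u z.2)
      linarith
  have := wd_upper volume (fun z : En n × En n => ‖z.1 - z.2‖ ^ (ε * p - n)) hw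
    (cube n c₁ ℓ ×ˢ cube n c₂ ℓ) hS v1 (by rw [v2]; positivity) _ _ (cD n ^ n) w0
    (fun z hz => (w1 _ (hρ z hz).1 (hρ z hz).2).1) (fun z hz => (w1 _ (hρ z hz).1 (hρ z hz).2).2) w2 w3
    (fun z => Hfun n p q s t ε a u z ^ pC p)
    (fun z => CG p q s t M Λ R / (d ^ (s + ε)) ^ p * |u z.1 - u z.2| ^ p)
    (fun z hz => Hg_nonneg n p q s t ε a ha u _ z) ?_ (hIntg.const_mul _)
  · rw [v2, integral_const_mul] at this
    unfold nu
    refine this.trans (le_of_eq ?_)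
    rw [mul_inv]; ring
  · intro z hz
    rw [H_pC n p q s t ε hp a ha]
    refine (G_le_U n p q s t ε M Λ R hp hpq hst a ha haM u hΛ z ((hρ z hz).2.trans hR)).trans ?_
    have : Ufun n s ε u z ^ p ≤ (|u z.1 - u z.2| / d ^ (s + ε)) ^ p := by
      apply Real.rpow_le_rpow (Ufun_nonneg n s ε u z) _ (by linarith)
      unfold Ufun
      apply div_le_div_of_nonneg_left (abs_nonneg _) (by positivity)
      exact Real.rpow_le_rpow hd0.le (hρ z hz).1 hsε
    rw [Real.div_rpow (abs_nonneg _) (by positivity)] at this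
    calc _ ≤ CG p q s t M Λ R * (|u z.1 - u z.2| ^ p / (d ^ (s + ε)) ^ p) := by gcongr
      _ = _ := by ring

theorem off_lower (n : ℕ) (p q s t ε M Λ R : ℝ) (hp : 2 ≤ p) (hpq : p ≤ q) (hst : t * q ≤ s * p)
    (hsε : 0 ≤ s + ε) (hεp0 : 0 ≤ ε * p) (hεp : ε * p ≤ n)
    (a : En n × En n → ℝ) (ham : Measurable a) (ha : ∀ z, 0 ≤ a z) (haM : ∀ z, a z ≤ M) (u : En n → ℝ)
    (hu : MemWsp n s p u) (hΛ : ∀ x, |u x| ≤ Λ)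
    (hη : 0 ≤ etaEx n p s ε) (hηp : etaEx n p s ε ≤ p)
    (c₁ c₂ : En n) (ℓ d : ℝ) (hℓ : 0 < ℓ)
    (hd : d = setDistE (cube n c₁ ℓ) (cube n c₂ ℓ)) (hℓd : ℓ ≤ d) (hR : cD n * d ≤ R) (hR0 : 0 ≤ R) :
    (ℓ ^ n)⁻¹ * (ℓ ^ n)⁻¹ * ∫ z in cube n c₁ ℓ ×ˢ cube n c₂ ℓ, |u z.1 - u z.2| ^ etaEx n p s ε ≤
     ((cD n * d) ^ (s + ε)) ^ etaEx n p s ε * (cD n ^ n *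
      ⨍ z in cube n c₁ ℓ ×ˢ cube n c₂ ℓ, Hfun n p q s t ε a u z ^ gammaEx n p s ε ∂nu n p ε) := by
  have hd0 : 0 < d := hℓ.trans_le hℓd
  have hc0 : 0 < cD n := by linarith [cD_one n]
  obtain ⟨w0, w1, w2, w3⟩ := weight_facts n p ε d (cD n) (cD_one n) hd0 hεp0 hεp
  obtain ⟨v1, v2⟩ := prod_volr n c₁ c₂ ℓ hℓ.le
  have hρ := rho_bounds n c₁ c₂ ℓ d hℓ hd hℓd
  have hS := (cube_meas n c₁ ℓ).prod (cube_meas n c₂ ℓ)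
  have hw : Measurable (fun z : En n × En n => ‖z.1 - z.2‖ ^ (ε * p - n)) := by fun_prop
  obtain ⟨hfin, -, -⟩ := wd_real volume (fun z : En n × En n => ‖z.1 - z.2‖ ^ (ε * p - n)) hw
    (cube n c₁ ℓ ×ˢ cube n c₂ ℓ) hS v1 _ _ w0
    (fun z hz => (w1 _ (hρ z hz).1 (hρ z hz).2).1) (fun z hz => (w1 _ (hρ z hz).1 (hρ z hz).2).2) w2
  have hInt := H_intOn n p q s t ε M Λ R hp hpq hst hR0 a ham ha haM u hu hΛ hη hηp _ hS
    (fun z hz => (hρ z hz).2.trans hR) hfin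
  set B := ((cD n * d) ^ (s + ε)) ^ etaEx n p s ε with hB
  have hB0 : 0 < B := by positivity
  have := wd_lower volume (fun z : En n × En n => ‖z.1 - z.2‖ ^ (ε * p - n)) hw
    (cube n c₁ ℓ ×ˢ cube n c₂ ℓ) hS v1 (by rw [v2]; positivity) _ _ (cD n ^ n) w0
    (fun z hz => (w1 _ (hρ z hz).1 (hρ z hz).2).1) (fun z hz => (w1 _ (hρ z hz).1 (hρ z hz).2).2) w2 w3
    (fun z => Hfun n p q s t ε a u z ^ gammaEx n p s ε)
    (fun z => B⁻¹ * |u z.1 - u z.2| ^ etaEx n p s ε)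
    (fun z hz => by positivity) ?_ hInt
  · rw [v2, integral_const_mul] at this
    unfold nu
    rw [← inv_mul_le_iff₀ hB0]
    refine (le_of_eq ?_).trans this
    rw [mul_inv]; ring
  · intro z hz
    refine le_trans ?_ (U_le_H n p q s t ε hp a ha u z hη)
    have : (|u z.1 - u z.2| / (cD n * d) ^ (s + ε)) ^ etaEx n p s ε ≤ Ufun n s ε u z ^ etaEx n p s ε := by
      apply Real.rpow_le_rpow (by positivity) _ hη
      unfold Ufun
      have : 0 < ‖z.1 - z.2‖ := hd0.trans_le (hρ z hz).1
      apply div_le_div_of_nonneg_left (abs_nonneg _) (by positivity)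
      exact Real.rpow_le_rpow (norm_nonneg _) (hρ z hz).2 hsε
    rw [Real.div_rpow (abs_nonneg _) (by positivity), div_eq_inv_mul] at this
    exact this


theorem diag_X (n : ℕ) (p η ε σ K N F ℓ : ℝ) (hp : 2 ≤ p) (hη : 1 ≤ η) (hε : 0 < ε)
    (hℓ : 0 < ℓ) (hK : 1 ≤ K) (hN : 0 ≤ N) (hF : 0 ≤ F)
    (hexp : (n + ε * p) / η = n / p + σ)
    (h : N ^ (η / p) ≤ K * (ℓ ^ (n + ε * p) / ε * F)) :
    ((ℓ ^ n)⁻¹ * N) ^ (1 / p) ≤ K * ℓ ^ σ * (F ^ (1 / η) / ε ^ (1 / η)) := by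
  have hη0 : 0 < η := by linarith
  have hp0 : 0 < p := by linarith
  have h1 : N ^ (1 / p) ≤ (K * (ℓ ^ (n + ε * p) / ε * F)) ^ (1 / η) := by
    have := Real.rpow_le_rpow (by positivity) h (by positivity : 0 ≤ 1 / η)
    rw [← Real.rpow_mul hN] at this
    have e : η / p * (1 / η) = 1 / p := by field_simp
    rwa [e] at this
  have h2 : K ^ (1 / η) ≤ K := by
    have := Real.rpow_le_rpow_of_exponent_le hK (show 1 / η ≤ 1 by rw [div_le_one hη0]; exact hη)
    rwa [Real.rpow_one] at this
  rw [Real.mul_rpow (by positivity) hN]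
  rw [Real.mul_rpow (by positivity) (by positivity), Real.mul_rpow (by positivity) hF,
    Real.div_rpow (by positivity) hε.le, ← Real.rpow_mul hℓ.le] at h1
  have e1 : (n + ε * p) * (1 / η) = n / p + σ := by rw [← hexp]; ring
  have e2 : ((ℓ ^ n)⁻¹) ^ (1 / p) = (ℓ ^ ((n : ℝ) / p))⁻¹ := by
    rw [Real.inv_rpow (by positivity), ← Real.rpow_natCast, ← Real.rpow_mul hℓ.le]
    congr 2; ring
  rw [e1, Real.rpow_add hℓ] at h1
  rw [e2]
  have hl : 0 < ℓ ^ ((n : ℝ) / p) := by positivity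
  calc (ℓ ^ ((n : ℝ) / p))⁻¹ * N ^ (1 / p)
      ≤ (ℓ ^ ((n : ℝ) / p))⁻¹ * (K ^ (1 / η) * (ℓ ^ ((n : ℝ) / p) * ℓ ^ σ / ε ^ (1 / η) * F ^ (1 / η))) := by
        gcongr
    _ = K ^ (1 / η) * ℓ ^ σ * (F ^ (1 / η) / ε ^ (1 / η)) := by field_simp
    _ ≤ _ := by gcongr

theorem rpow_three (A B C k : ℝ) (hA : 0 ≤ A) (hB : 0 ≤ B) (hC : 0 ≤ C) (hk : 0 ≤ k) :
    (A + B + C) ^ k ≤ 3 ^ k * (A ^ k + B ^ k + C ^ k) := by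
  have hm : ∀ m, 0 ≤ m → A ≤ m → B ≤ m → C ≤ m → (A + B + C) ^ k ≤ 3 ^ k * m ^ k := by
    intro m hm h1 h2 h3
    rw [← Real.mul_rpow (by norm_num) hm]
    exact Real.rpow_le_rpow (by positivity) (by linarith) hk
  have a1 := Real.rpow_nonneg hA k
  have a2 := Real.rpow_nonneg hB k
  have a3 := Real.rpow_nonneg hC k
  rcases le_total A B with h1 | h1
  · rcases le_total B C with h2 | h2
    · exact (hm C hC (by linarith) h2 le_rfl).trans (by gcongr; linarith)
    · exact (hm B hB h1 le_rfl h2).trans (by gcongr; linarith)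
  · rcases le_total A C with h2 | h2
    · exact (hm C hC h2 (by linarith) le_rfl).trans (by gcongr; linarith)
    · exact (hm A hA le_rfl h1 h2).trans (by gcongr; linarith)

theorem rpow_inv_le_self (K b : ℝ) (hK : 1 ≤ K) (hb : b ≤ 1) : K ^ b ≤ K := by
  have := Real.rpow_le_rpow_of_exponent_le hK hb
  rwa [Real.rpow_one] at this

theorem final_alg (p η ε σ K cn c G L P Q F F₁ F₂ X₁ X₂ ℓ d : ℝ) (hp : 2 ≤ p) (hη : 1 ≤ η)
    (hε : 0 < ε) (hσ : 0 < σ) (hσ1 : σ ≤ 1) (hℓ : 0 < ℓ) (hd : 0 < d) (hK : 1 ≤ K) (hcn : 1 ≤ cn) (hc : 1 ≤ c)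
    (hG : 1 ≤ G) (hL0 : 0 ≤ L) (hP0 : 0 ≤ P) (hQ0 : 0 ≤ Q) (hF : 0 ≤ F) (hF₁ : 0 ≤ F₁) (hF₂ : 0 ≤ F₂)
    (hL : L ≤ cn * (G / (d ^ σ) ^ p * P)) (hQ : Q ≤ ((c * d) ^ σ) ^ η * (cn * F))
    (hP : P ^ (1 / p) ≤ 2 * X₁ + 2 * X₂ + Q ^ (1 / η))
    (hX₁ : X₁ ≤ K * ℓ ^ σ * (F₁ ^ (1 / η) / ε ^ (1 / η)))
    (hX₂ : X₂ ≤ K * ℓ ^ σ * (F₂ ^ (1 / η) / ε ^ (1 / η))) :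
    L ^ (1 / p * (p - 1)) ≤ (3 * (cn * G * (c * cn + 2 * K))) ^ (p - 1) * F ^ (1 / η * (p - 1)) +
      (3 * (cn * G * (c * cn + 2 * K))) ^ (p - 1) / ε ^ (1 / η * (p - 1)) * (ℓ / d) ^ ((p - 1) * σ) *
      (F₁ ^ (1 / η * (p - 1)) + F₂ ^ (1 / η * (p - 1))) := by
  have hη0 : 0 < η := by linarith
  have hp0 : 0 < p := by linarith
  have hcn0 : 0 < cn := by linarith
  have hG0 : 0 < G := by linarith
  have hc0 : 0 < c := by linarith
  have hK0 : 0 < K := by linarith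
  have hp1 : 1 / p ≤ 1 := by rw [div_le_one hp0]; linarith
  have hη1 : 1 / η ≤ 1 := by rw [div_le_one hη0]; linarith
  set D := d ^ σ with hD
  have hD0 : 0 < D := by positivity
  set f := F ^ (1 / η) with hf
  set f₁ := F₁ ^ (1 / η) with hf₁
  set f₂ := F₂ ^ (1 / η) with hf₂
  set e := ε ^ (1 / η) with he
  have f0 : 0 ≤ f := by positivity
  have f10 : 0 ≤ f₁ := by positivity
  have f20 : 0 ≤ f₂ := by positivity
  have e0 : 0 < e := by positivity
  have hr : (ℓ / d) ^ σ = ℓ ^ σ / D := Real.div_rpow hℓ.le hd.le _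
  set r := (ℓ / d) ^ σ with hrr
  have r0 : 0 ≤ r := by positivity
  have l0 : 0 ≤ ℓ ^ σ := by positivity
  have hlr : ℓ ^ σ = r * D := by rw [hr]; field_simp
  have h1 : L ^ (1 / p) ≤ cn * G / D * P ^ (1 / p) := by
    have := Real.rpow_le_rpow hL0 hL (by positivity : 0 ≤ 1 / p)
    have e3 : cn * (G / D ^ p * P) = (cn * G) * (1 / D) ^ p * P := by
      rw [Real.div_rpow (by norm_num) hD0.le, Real.one_rpow]; ring
    rw [e3, Real.mul_rpow (by positivity) hP0, Real.mul_rpow (by positivity) (by positivity),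
      ← Real.rpow_mul (by positivity : 0 ≤ 1 / D), mul_one_div_cancel hp0.ne', Real.rpow_one] at this
    refine this.trans ?_
    have := rpow_inv_le_self (cn * G) (1 / p) (by nlinarith) hp1
    calc _ ≤ (cn * G) * (1 / D) * P ^ (1 / p) := by gcongr
      _ = _ := by ring
  have h2 : Q ^ (1 / η) ≤ c * cn * D * f := by
    have := Real.rpow_le_rpow hQ0 hQ (by positivity : 0 ≤ 1 / η)
    rw [Real.mul_rpow (by positivity) (by positivity), Real.mul_rpow (by positivity) hF,
      ← Real.rpow_mul (by positivity : 0 ≤ (c * d) ^ σ), mul_one_div_cancel hη0.ne', Real.rpow_one,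
      Real.mul_rpow hc0.le hd.le] at this
    refine this.trans ?_
    have k1 := rpow_inv_le_self c σ hc hσ1
    have k2 := rpow_inv_le_self cn (1 / η) hcn hη1
    calc c ^ σ * D * (cn ^ (1 / η) * f) ≤ c * D * (cn * f) := by gcongr
      _ = _ := by ring
  set C2 := cn * G * (c * cn + 2 * K) with hC2
  have hC20 : 0 < C2 := by positivity
  have h3 : L ^ (1 / p) ≤ C2 * (f + r * (f₁ / e) + r * (f₂ / e)) := by
    refine h1.trans ?_
    have : P ^ (1 / p) ≤ 2 * (K * (r * D) * (f₁ / e)) + 2 * (K * (r * D) * (f₂ / e)) + c * cn * D * f := by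
      rw [hlr] at hX₁ hX₂
      linarith
    calc cn * G / D * P ^ (1 / p) ≤ cn * G / D *
          (2 * (K * (r * D) * (f₁ / e)) + 2 * (K * (r * D) * (f₂ / e)) + c * cn * D * f) := by gcongr
      _ = cn * G * (2 * K * (r * (f₁ / e)) + 2 * K * (r * (f₂ / e)) + c * cn * f) := by field_simp
      _ ≤ cn * G * ((c * cn + 2 * K) * (r * (f₁ / e)) + (c * cn + 2 * K) * (r * (f₂ / e))
            + (c * cn + 2 * K) * f) := by
          have : 0 ≤ c * cn := by positivity
          gcongr <;> linarith
      _ = _ := by rw [hC2]; ring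
  have hp1' : 0 ≤ p - 1 := by linarith
  have h4 := Real.rpow_le_rpow (by positivity) h3 hp1'
  have t1 : 0 ≤ r * (f₁ / e) := by positivity
  have t2 : 0 ≤ r * (f₂ / e) := by positivity
  have h5 := rpow_three f (r * (f₁ / e)) (r * (f₂ / e)) (p - 1) f0 t1 t2 hp1'
  rw [Real.mul_rpow hC20.le (by positivity)] at h4
  rw [Real.mul_rpow r0 (by positivity), Real.mul_rpow r0 (by positivity), Real.div_rpow f10 e0.le,
    Real.div_rpow f20 e0.le] at h5
  have g1 : (ℓ / d) ^ ((p - 1) * σ) = r ^ (p - 1) := by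
    rw [hrr, ← Real.rpow_mul (by positivity), mul_comm]
  rw [Real.rpow_mul hL0, Real.rpow_mul hF, Real.rpow_mul hF₁, Real.rpow_mul hF₂, Real.rpow_mul hε.le, g1,
    Real.mul_rpow (by norm_num : (0:ℝ) ≤ 3) hC20.le]
  calc _ ≤ _ := h4
    _ ≤ C2 ^ (p - 1) * (3 ^ (p - 1) * (f ^ (p - 1) + r ^ (p - 1) * (f₁ ^ (p - 1) / e ^ (p - 1))
         + r ^ (p - 1) * (f₂ ^ (p - 1) / e ^ (p - 1)))) := by gcongr
    _ = _ := by ring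

theorem eta_facts (n : ℕ) (hn : 2 ≤ n) (p s ε : ℝ) (hp : 2 ≤ p) (hs0 : 0 < s) (hs1 : s < 1) (hε : 0 < ε)
    (hεs : ε * p < s) :
    1 ≤ etaEx n p s ε ∧ etaEx n p s ε < p ∧
    (n : ℝ) < n - ε * p + (s + ε) * etaEx n p s ε ∧
    n * (etaEx n p s ε / p) = 2 * n - (n - ε * p + (s + ε) * etaEx n p s ε) ∧
    (n + ε * p) / etaEx n p s ε = n / p + (s + ε) := by
  have hn' : (2 : ℝ) ≤ n := by exact_mod_cast hn
  have hεp : 0 < ε * p := by positivity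
  have hsp : 0 < s * p := by positivity
  have hsp' : s * p < p := by nlinarith
  have hden : 0 < (n : ℝ) + s * p + ε * p := by positivity
  have hnum : 0 < (n : ℝ) * p + ε * p ^ 2 := by positivity
  have hp0 : p ≠ 0 := by linarith
  have hid : etaEx n p s ε * (n + s * p + ε * p) = n * p + ε * p ^ 2 := by
    unfold etaEx; field_simp
  have hη1 : 1 ≤ etaEx n p s ε := by
    unfold etaEx
    rw [le_div_iff₀ hden]
    nlinarith
  set η := etaEx n p s ε
  refine ⟨hη1, ?_, ?_, ?_, ?_⟩
  · by_contra h
    push Not at h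
    have := mul_le_mul_of_nonneg_right h hden.le
    rw [hid] at this
    nlinarith
  · have : 0 < ((s + ε) * η - ε * p) * (n + s * p + ε * p) := by
      have : ((s + ε) * η - ε * p) * (n + s * p + ε * p) = n * p * s := by
        linear_combination (s + ε) * hid
      rw [this]; positivity
    have := (mul_pos_iff_of_pos_right hden).1 this
    linarith
  · field_simp
    linear_combination hid
  · have : η ≠ 0 := by linarith
    field_simp
    linear_combination -hid


/-- **Lemma 4.7, off-diagonal almost-reverse Hölder inequality**:
for `n ≥ 2`, `p ∈ [2,∞)`, `q ∈ [p,∞)`, `t ≤ s`, `1/p' ≤ tq/(sp) ≤ 1`, `0 ≤ a ≤ M`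
symmetric, `ε ∈ (0,s/p)` with `ε < 1−s`, and any `u ∈ W^{s,p}(ℝⁿ) ∩ L^∞(ℝⁿ)` (not
necessarily a solution), there is `C_nd = C_nd(n,p,q,s,t,M,‖u‖_∞)`, independent of `ε`,
such that for every `k ∈ ℤ` and axis-parallel cubes `K₁,K₂` of side `2^{−k}` with
`2^{−k} ≤ dist(K₁,K₂) ≤ 3`, writing `𝒦 = K₁ × K₂`:
`(⨍_𝒦 H^{p'} dν)^{1/p'} ≤ C_nd (⨍_𝒦 H^γ dν)^{1/γ}
  + C_nd ε^{−1/γ} (2^{−k}/dist(K₁,K₂))^{(p−1)(s+ε)}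
      [(⨍_{K₁×K₁} H^γ dν)^{1/γ} + (⨍_{K₂×K₂} H^γ dν)^{1/γ}]`. -/
theorem stmt_15 (n : ℕ) (hn : 2 ≤ n) (p q s t M Λ : ℝ)
    (hp : 2 ≤ p) (hpq : p ≤ q)
    (hs0 : 0 < s) (hs1 : s < 1) (ht0 : 0 < t) (ht1 : t < 1) (hts : t ≤ s)
    (hlow : 1 / pC p ≤ t * q / (s * p)) (hhigh : t * q / (s * p) ≤ 1) :
    ∃ Cnd : ℝ, 0 < Cnd ∧
      ∀ ε : ℝ, 0 < ε → ε < s / p → ε < 1 - s →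
      ∀ a : En n × En n → ℝ, Measurable a →
        (∀ z, 0 ≤ a z) → (∀ z, a z ≤ M) → (∀ x y, a (x, y) = a (y, x)) →
      ∀ u : En n → ℝ, MemWsp n s p u → (∀ x, |u x| ≤ Λ) →
      ∀ (k : ℤ) (c₁ c₂ : En n),
      ∀ K₁ K₂ : Set (En n),
        K₁ = cube n c₁ ((2 : ℝ) ^ (-k)) → K₂ = cube n c₂ ((2 : ℝ) ^ (-k)) →
        (2 : ℝ) ^ (-k) ≤ setDistE K₁ K₂ → setDistE K₁ K₂ ≤ 3 →
        (⨍ z in K₁ ×ˢ K₂, Hfun n p q s t ε a u z ^ pC p ∂nu n p ε) ^ (1 / pC p) ≤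
          Cnd * (⨍ z in K₁ ×ˢ K₂,
              Hfun n p q s t ε a u z ^ gammaEx n p s ε ∂nu n p ε) ^ (1 / gammaEx n p s ε)
            + Cnd / ε ^ (1 / gammaEx n p s ε) *
                ((2 : ℝ) ^ (-k) / setDistE K₁ K₂) ^ ((p - 1) * (s + ε)) *
                ((⨍ z in K₁ ×ˢ K₁,
                    Hfun n p q s t ε a u z ^ gammaEx n p s ε ∂nu n p ε) ^
                      (1 / gammaEx n p s ε)
                  + (⨍ z in K₂ ×ˢ K₂,
                      Hfun n p q s t ε a u z ^ gammaEx n p s ε ∂nu n p ε) ^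
                        (1 / gammaEx n p s ε)) := by
  have hn' : (2 : ℝ) ≤ n := by exact_mod_cast hn
  have hsp : 0 < s * p := by nlinarith
  have hst : t * q ≤ s * p := by
    rw [div_le_one hsp] at hhigh
    exact hhigh
  have hc1 := cD_one n
  have hcn1 : 1 ≤ cD n ^ n := one_le_pow₀ hc1
  have hCG : 1 ≤ CG p q s t M Λ (3 * cD n) := by
    unfold CG
    have : 0 ≤ |M| * (2 * |Λ|) ^ (q - p) * (3 * cD n) ^ (s * p - t * q) := by positivity
    linarith
  set K := max 1 (Csob n p * CE n) with hK
  have hK1 : 1 ≤ K := le_max_left _ _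
  set Cn := (3 * (cD n ^ n * CG p q s t M Λ (3 * cD n) * (cD n * cD n ^ n + 2 * K))) ^ (p - 1) with hCn
  refine ⟨Cn, ?_, ?_⟩
  · have : 0 < cD n := by linarith
    have : 0 < CG p q s t M Λ (3 * cD n) := by linarith
    have : 0 < K := by linarith
    positivity
  intro ε hε hεs hεs1 a ham ha haM hsym u hu hΛ k c₁ c₂ K₁ K₂ hK₁ hK₂ hkd hd3
  have hp0 : 0 < p := by linarith
  have hεp : ε * p < s := by rwa [lt_div_iff₀ hp0] at hεs
  have hεp0 : 0 ≤ ε * p := by positivity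
  obtain ⟨hη1, hηp, hnκ, hcrit, hexp⟩ := eta_facts n hn p s ε hp hs0 hs1 hε hεp
  have hℓ : (0 : ℝ) < 2 ^ (-k) := by positivity
  generalize hℓe : (2 : ℝ) ^ (-k) = ℓ at *
  generalize hd : setDistE K₁ K₂ = d at *
  subst hK₁ hK₂
  have hR : cD n * d ≤ 3 * cD n := by nlinarith
  have hR0 : 0 ≤ 3 * cD n := by linarith
  have hη0 : 0 ≤ etaEx n p s ε := by linarith
  have hℓR : Real.sqrt n * ℓ ≤ 3 * cD n := by
    unfold cD
    have := Real.sqrt_nonneg n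
    nlinarith
  have e1 : 1 / pC p = 1 / p * (p - 1) := by
    unfold pC
    have : p - 1 ≠ 0 := by linarith
    field_simp
  have e2 : 1 / gammaEx n p s ε = 1 / etaEx n p s ε * (p - 1) := by
    rw [gamma_eq]
    have : p - 1 ≠ 0 := by linarith
    field_simp
  have hFnn : ∀ (S : Set (En n × En n)) (γ : ℝ),
      0 ≤ ⨍ z in S, Hfun n p q s t ε a u z ^ γ ∂nu n p ε := by
    intro S γ
    rw [setAverage_eq, smul_eq_mul]
    exact mul_nonneg (by positivity) (integral_nonneg fun z => Hg_nonneg n p q s t ε a ha u _ z)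
  have hX : ∀ c : En n, ((ℓ ^ n)⁻¹ * ∫ x in cube n c ℓ, |u x - ⨍ y in cube n c ℓ, u y| ^ p) ^ (1 / p) ≤
      K * ℓ ^ (s + ε) * ((⨍ z in cube n c ℓ ×ˢ cube n c ℓ,
        Hfun n p q s t ε a u z ^ gammaEx n p s ε ∂nu n p ε) ^ (1 / etaEx n p s ε) /
          ε ^ (1 / etaEx n p s ε)) := by
    intro c
    have h := diag_est n hn p q s t ε M Λ (3 * cD n) _ hp hpq hst hR0 hε (by linarith) a ham ha haM u hu hΛ
      hη1 hηp rfl hnκ hcrit c ℓ hℓ hℓR _ rfl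
    refine diag_X n p _ ε _ K _ _ ℓ hp hη1 hε hℓ hK1
      (integral_nonneg fun x => by positivity) (hFnn _ _) hexp (h.trans ?_)
    have h0 := hFnn (cube n c ℓ ×ˢ cube n c ℓ) (gammaEx n p s ε)
    have hKm : Csob n p * CE n ≤ K := le_max_right _ _
    calc _ = Csob n p * CE n * (ℓ ^ (n + ε * p) / ε * ⨍ z in cube n c ℓ ×ˢ cube n c ℓ,
            Hfun n p q s t ε a u z ^ gammaEx n p s ε ∂nu n p ε) := by ring
      _ ≤ _ := mul_le_mul_of_nonneg_right hKm (by positivity)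
  have hTri := cube_tri n c₁ c₂ ℓ hℓ u hu.1 Λ hΛ (⨍ y in cube n c₁ ℓ, u y) (⨍ y in cube n c₂ ℓ, u y) p
    (etaEx n p s ε) hη1 hηp.le
  have hUp := off_upper n p q s t ε M Λ (3 * cD n) hp hpq hst (by linarith) hεp0 (by linarith) a ha haM u hu.1
    hΛ c₁ c₂ ℓ d hℓ hd.symm hkd hR hR0
  have hLo := off_lower n p q s t ε M Λ (3 * cD n) hp hpq hst (by linarith) hεp0 (by linarith) a ham ha haM u hu
    hΛ hη0 hηp.le c₁ c₂ ℓ d hℓ hd.symm hkd hR hR0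
  rw [e1, e2]
  exact final_alg p _ ε (s + ε) K (cD n ^ n) (cD n) _ _ _ _ _ _ _ _ _ ℓ d hp hη1 hε (by linarith)
    (by linarith) hℓ (by linarith) hK1 hcn1 hc1 hCG (hFnn _ _)
    (mul_nonneg (by positivity) (integral_nonneg fun x => by positivity))
    (mul_nonneg (by positivity) (integral_nonneg fun x => by positivity))
    (hFnn _ _) (hFnn _ _) (hFnn _ _) hUp hLo hTri (hX c₁) (hX c₂)

end
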